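/- Let G be a pattern graph in which the !-vertex b₂ is nested in the !-vertex b₁, i.e., there is an edge e from b₁ to b₂, and suppose the graph H = G∖e obtained by deleting the edge e is again a pattern graph. Then every instance of H is an instance of G. -/

import Mathlib

/-- Vertex types: node-vertices, wire-vertices and `!`-vertices. -/
inductive VTy : Type
  | node | wire | bang
  deriving DecidableEq

/-- A directed graph whose vertices are typed by `VTy`. -/
structure TGraph (V E : Type) where
  s : E → V
  t : E → V
  ty : V → VTy

namespace TGraph

variable {V E : Type}

/-- No edge has both a node-vertex source and a node-vertex target. -/
def NoNodeNode (G : TGraph V E) : Prop :=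
  ∀ e, ¬ (G.ty (G.s e) = .node ∧ G.ty (G.t e) = .node)

/-- A `G₂`-typed graph: only node- and wire-vertices, no node-node edges. -/
def IsG2 (G : TGraph V E) : Prop :=
  G.NoNodeNode ∧ ∀ v, G.ty v ≠ .bang

/-- A `G₃`-typed graph: no node-node edges, and every edge into a `!`-vertex
comes from a `!`-vertex. -/
def IsG3 (G : TGraph V E) : Prop :=
  G.NoNodeNode ∧ ∀ e, G.ty (G.t e) = .bang → G.ty (G.s e) = .bang

/-- An input: a wire-vertex all of whose in-edges have `!`-vertex sources.
In a `G₂`-typed graph this says exactly: a wire-vertex with no in-edges. -/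
def IsInput (G : TGraph V E) (v : V) : Prop :=
  G.ty v = .wire ∧ ∀ e, G.t e = v → G.ty (G.s e) = .bang

/-- An output: a wire-vertex with no out-edges. -/
def IsOutput (G : TGraph V E) (v : V) : Prop :=
  G.ty v = .wire ∧ ∀ e, G.s e ≠ v

/-- A string graph: a `G₂`-typed graph where every wire-vertex has at most one
in-edge and at most one out-edge. -/
def IsStringGraph (G : TGraph V E) : Prop :=
  G.IsG2 ∧ ∀ v, G.ty v = .wire →
    (∀ e₁ e₂, G.t e₁ = v → G.t e₂ = v → e₁ = e₂) ∧
    (∀ e₁ e₂, G.s e₁ = v → G.s e₂ = v → e₁ = e₂)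

/-- The set of successors of a vertex. -/
def bsucc (G : TGraph V E) (b : V) : Set V := {v | ∃ e, G.s e = b ∧ G.t e = v}

/-- The set of predecessors of a vertex. -/
def bpred (G : TGraph V E) (b : V) : Set V := {v | ∃ e, G.s e = v ∧ G.t e = b}

/-- The full subgraph on a set of vertices, as a standalone graph. -/
def restrict (G : TGraph V E) (S : Set V) :
    TGraph {v : V // v ∈ S} {e : E // G.s e ∈ S ∧ G.t e ∈ S} where
  s e := ⟨G.s e.1, e.2.1⟩
  t e := ⟨G.t e.1, e.2.2⟩
  ty v := G.ty v.1

/-- A subgraph of a graph. -/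
structure Sub (G : TGraph V E) where
  verts : Set V
  edges : Set E
  s_mem : ∀ e ∈ edges, G.s e ∈ verts
  t_mem : ∀ e ∈ edges, G.t e ∈ verts

namespace Sub

variable {G : TGraph V E}

/-- The whole graph as a subgraph of itself. -/
def top (G : TGraph V E) : Sub G :=
  ⟨Set.univ, Set.univ, fun _ _ => trivial, fun _ _ => trivial⟩

def inter (A B : Sub G) : Sub G :=
  ⟨A.verts ∩ B.verts, A.edges ∩ B.edges,
    fun e he => ⟨A.s_mem e he.1, B.s_mem e he.2⟩,
    fun e he => ⟨A.t_mem e he.1, B.t_mem e he.2⟩⟩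

def union (A B : Sub G) : Sub G :=
  ⟨A.verts ∪ B.verts, A.edges ∪ B.edges,
    fun e he => he.elim (fun h => Or.inl (A.s_mem e h)) (fun h => Or.inr (B.s_mem e h)),
    fun e he => he.elim (fun h => Or.inl (A.t_mem e h)) (fun h => Or.inr (B.t_mem e h))⟩

/-- `H∖A` : the largest subgraph of `H` that is disjoint from `A`
(the full subgraph of `H` on the vertices of `H` not in `A`). -/
def minus (H A : Sub G) : Sub G :=
  ⟨H.verts \ A.verts, {e | e ∈ H.edges ∧ G.s e ∉ A.verts ∧ G.t e ∉ A.verts},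
    fun e he => ⟨H.s_mem e he.1, he.2.1⟩,
    fun e he => ⟨H.t_mem e he.1, he.2.2⟩⟩

/-- An input of a subgraph: a wire-vertex of the subgraph all of whose in-edges
(inside the subgraph) have `!`-vertex sources. -/
def IsInput (A : Sub G) (v : V) : Prop :=
  v ∈ A.verts ∧ G.ty v = .wire ∧ ∀ e ∈ A.edges, G.t e = v → G.ty (G.s e) = .bang

/-- An output of a subgraph: a wire-vertex of the subgraph with no out-edges
inside the subgraph. -/
def IsOutput (A : Sub G) (v : V) : Prop :=
  v ∈ A.verts ∧ G.ty v = .wire ∧ ∀ e ∈ A.edges, G.s e ≠ v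

/-- `A` is open in `H`: `In(H∖A) ⊆ In(H)` and `Out(H∖A) ⊆ Out(H)`. -/
def IsOpenIn (A H : Sub G) : Prop :=
  (∀ v, (H.minus A).IsInput v → H.IsInput v) ∧
  (∀ v, (H.minus A).IsOutput v → H.IsOutput v)

/-- `A` is an open subgraph of `G`. -/
def IsOpen (A : Sub G) : Prop := A.IsOpenIn (top G)

end Sub

/-- The full subgraph on a vertex set, as a subgraph. -/
def fullSub (G : TGraph V E) (S : Set V) : Sub G :=
  ⟨S, {e | G.s e ∈ S ∧ G.t e ∈ S}, fun _ he => he.1, fun _ he => he.2⟩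

/-- `B(b)` : the `!`-box of `b`, i.e. the full subgraph on the successors of `b`. -/
def bbox (G : TGraph V E) (b : V) : Sub G := G.fullSub (G.bsucc b)

/-- Edges of `Σ(G)`, the full subgraph on node- and wire-vertices. -/
def sigmaEdges (G : TGraph V E) : Set E :=
  {e | G.ty (G.s e) ≠ .bang ∧ G.ty (G.t e) ≠ .bang}

/-- Edges of `β(G)`, the full subgraph on `!`-vertices. -/
def betaEdges (G : TGraph V E) : Set E :=
  {e | G.ty (G.s e) = .bang ∧ G.ty (G.t e) = .bang}

/-- `Σ(G)` is a string graph. -/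
def SigmaIsStringGraph (G : TGraph V E) : Prop :=
  G.NoNodeNode ∧ ∀ v, G.ty v = .wire →
    (∀ e₁ e₂, e₁ ∈ G.sigmaEdges → e₂ ∈ G.sigmaEdges → G.t e₁ = v → G.t e₂ = v → e₁ = e₂) ∧
    (∀ e₁ e₂, e₁ ∈ G.sigmaEdges → e₂ ∈ G.sigmaEdges → G.s e₁ = v → G.s e₂ = v → e₁ = e₂)

/-- `β(G)` is posetal: simple and, as a relation on `!`-vertices, a partial order. -/
def BetaPosetal (G : TGraph V E) : Prop :=
  (∀ e₁ e₂, e₁ ∈ G.betaEdges → e₂ ∈ G.betaEdges →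
    G.s e₁ = G.s e₂ → G.t e₁ = G.t e₂ → e₁ = e₂) ∧
  (∀ b, G.ty b = .bang → b ∈ G.bsucc b) ∧
  (∀ b b', G.ty b = .bang → G.ty b' = .bang →
    b' ∈ G.bsucc b → b ∈ G.bsucc b' → b = b') ∧
  (∀ a b c, G.ty a = .bang → G.ty b = .bang → G.ty c = .bang →
    b ∈ G.bsucc a → c ∈ G.bsucc b → c ∈ G.bsucc a)

/-- A pattern graph. -/
def IsPattern (G : TGraph V E) : Prop :=
  G.IsG3 ∧ G.SigmaIsStringGraph ∧ G.BetaPosetal ∧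
  (∀ b, G.ty b = .bang → (G.bbox b).IsOpen) ∧
  (∀ b b', G.ty b = .bang → G.ty b' = .bang → b' ∈ G.bsucc b →
    G.bsucc b' ⊆ G.bsucc b)

end TGraph

namespace TGraph

variable {V E V' E' V'' E'' : Type}

/-- A morphism of typed graphs. -/
structure GHom (G : TGraph V E) (H : TGraph V' E') where
  fv : V → V'
  fe : E → E'
  map_s : ∀ e, H.s (fe e) = fv (G.s e)
  map_t : ∀ e, H.t (fe e) = fv (G.t e)
  map_ty : ∀ v, H.ty (fv v) = G.ty v

namespace GHom

variable {G : TGraph V E} {H : TGraph V' E'} {K : TGraph V'' E''}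

protected def id (G : TGraph V E) : GHom G G :=
  ⟨fun v => v, fun e => e, fun _ => rfl, fun _ => rfl, fun _ => rfl⟩

def comp (g : GHom H K) (f : GHom G H) : GHom G K where
  fv v := g.fv (f.fv v)
  fe e := g.fe (f.fe e)
  map_s e := by rw [g.map_s, f.map_s]
  map_t e := by rw [g.map_t, f.map_t]
  map_ty v := by rw [g.map_ty, f.map_ty]

theorem mem_bsucc (f : GHom G H) {b v : V} (h : v ∈ G.bsucc b) :
    f.fv v ∈ H.bsucc (f.fv b) := by
  obtain ⟨e, hs, ht⟩ := h
  exact ⟨f.fe e, by rw [f.map_s, hs], by rw [f.map_t, ht]⟩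

theorem mem_bpred (f : GHom G H) {b v : V} (h : v ∈ G.bpred b) :
    f.fv v ∈ H.bpred (f.fv b) := by
  obtain ⟨e, hs, ht⟩ := h
  exact ⟨f.fe e, by rw [f.map_s, hs], by rw [f.map_t, ht]⟩

end GHom

/-- An isomorphism of typed graphs. -/
structure GIso (G : TGraph V E) (H : TGraph V' E') where
  toHom : GHom G H
  fv_bij : Function.Bijective toHom.fv
  fe_bij : Function.Bijective toHom.fe

end TGraph

namespace TGraph

variable {V E : Type}

open Classical in
/-- The canonical map into the vertex set of `COPY_b(G)`: vertices of `B(b)`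
go to the second copy, all other vertices to the (shared) first copy. -/
noncomputable def embed (G : TGraph V E) (b v : V) : V ⊕ {w : V // w ∈ G.bsucc b} :=
  if h : v ∈ G.bsucc b then Sum.inr ⟨v, h⟩ else Sum.inl v

theorem embed_of_mem (G : TGraph V E) {b v : V} (h : v ∈ G.bsucc b) :
    G.embed b v = Sum.inr ⟨v, h⟩ := by
  simp [embed, h]

theorem embed_of_not_mem (G : TGraph V E) {b v : V} (h : v ∉ G.bsucc b) :
    G.embed b v = Sum.inl v := by
  simp [embed, h]

/-- `COPY_b(G)` : the pushout of the inclusion `G∖B(b) ↪ G` along itself,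
computed concretely: two copies of `G` glued along `G∖B(b)`. -/
noncomputable def copyGraph (G : TGraph V E) (b : V) :
    TGraph (V ⊕ {w : V // w ∈ G.bsucc b})
      (E ⊕ {e : E // G.s e ∈ G.bsucc b ∨ G.t e ∈ G.bsucc b}) where
  s := Sum.elim (fun e => Sum.inl (G.s e)) (fun e => G.embed b (G.s e.1))
  t := Sum.elim (fun e => Sum.inl (G.t e)) (fun e => G.embed b (G.t e.1))
  ty := Sum.elim G.ty fun v => G.ty v.1

/-- `DROP_b(G) = G∖{b}`. -/
def dropGraph (G : TGraph V E) (b : V) :=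
  G.restrict {v : V | v ≠ b}

/-- `KILL_b(G) = G∖B(b)`. -/
def killGraph (G : TGraph V E) (b : V) :=
  G.restrict {v : V | v ∉ G.bsucc b}

end TGraph

namespace TGraph

variable {V E : Type}

/-- The vertex identification performed by `MERGE_{b,b'}`: `b` and `b'` are
identified. -/
def mergeVRel (b b' : V) (v₁ v₂ : V) : Prop :=
  v₁ = v₂ ∨ (v₁ = b ∧ v₂ = b') ∨ (v₁ = b' ∧ v₂ = b)

/-- The edges of `B↑(b)`, the full subgraph on the predecessors of `b`. -/
def upEdges (G : TGraph V E) (b : V) : Set E :=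
  {e | G.s e ∈ G.bpred b ∧ G.t e ∈ G.bpred b}

/-- The edge identification performed by `MERGE_{b,b'}`: an edge of `B↑(b)` is
identified with the corresponding edge of `B↑(b')`. -/
def mergeERel (G : TGraph V E) (b b' : V) (e₁ e₂ : E) : Prop :=
  e₁ = e₂ ∨
    (e₁ ∈ G.upEdges b ∧ e₂ ∈ G.upEdges b' ∧
      Quot.mk (mergeVRel b b') (G.s e₁) = Quot.mk (mergeVRel b b') (G.s e₂) ∧
      Quot.mk (mergeVRel b b') (G.t e₁) = Quot.mk (mergeVRel b b') (G.t e₂)) ∨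
    (e₁ ∈ G.upEdges b' ∧ e₂ ∈ G.upEdges b ∧
      Quot.mk (mergeVRel b b') (G.s e₁) = Quot.mk (mergeVRel b b') (G.s e₂) ∧
      Quot.mk (mergeVRel b b') (G.t e₁) = Quot.mk (mergeVRel b b') (G.t e₂))

open Classical in
/-- `MERGE_{b,b'}(G)` : the coequaliser of the inclusion `B↑(b) ↪ G` and the
composite of the canonical isomorphism `B↑(b) ≅ B↑(b')` with `B↑(b') ↪ G`,
computed concretely as a quotient of `G`. -/
noncomputable def mergeGraph (G : TGraph V E) (b b' : V) :
    TGraph (Quot (mergeVRel b b')) (Quot (G.mergeERel b b')) where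
  s := Quot.lift (fun e => Quot.mk _ (G.s e)) (by
    intro e₁ e₂ h
    rcases h with h | h | h
    · rw [h]
    · exact h.2.2.1
    · exact h.2.2.1)
  t := Quot.lift (fun e => Quot.mk _ (G.t e)) (by
    intro e₁ e₂ h
    rcases h with h | h | h
    · rw [h]
    · exact h.2.2.2
    · exact h.2.2.2)
  ty := Quot.lift (fun v => if v = b' then G.ty b else G.ty v) (by
    intro v₁ v₂ h
    rcases h with h | ⟨h1, h2⟩ | ⟨h1, h2⟩
    · rw [h]
    · subst h1; subst h2; simp
    · subst h1; subst h2; simp)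

open Classical in
theorem mergeGraph_ty_mk (G : TGraph V E) (b b' v : V) :
    (G.mergeGraph b b').ty (Quot.mk _ v) = if v = b' then G.ty b else G.ty v := rfl

end TGraph

namespace TGraph

/-- A bundled typed graph. -/
structure BGraph : Type 1 where
  V : Type
  E : Type
  G : TGraph V E

/-- Deleting a single edge from a graph. -/
def delEdge {V E : Type} (G : TGraph V E) (e₀ : E) : TGraph V {e : E // e ≠ e₀} where
  s e := G.s e.1
  t e := G.t e.1
  ty := G.ty

/-- A single application of one of the four `!`-box operations. -/
inductive OpStep : BGraph → BGraph → Prop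
  | copy (A : BGraph) (b : A.V) (hb : A.G.ty b = .bang) :
      OpStep A ⟨_, _, A.G.copyGraph b⟩
  | drop (A : BGraph) (b : A.V) (hb : A.G.ty b = .bang) :
      OpStep A ⟨_, _, A.G.dropGraph b⟩
  | kill (A : BGraph) (b : A.V) (hb : A.G.ty b = .bang) :
      OpStep A ⟨_, _, A.G.killGraph b⟩
  | merge (A : BGraph) (b b' : A.V) (hb : A.G.ty b = .bang) (hb' : A.G.ty b' = .bang)
      (hpred : A.G.bpred b \ {b} = A.G.bpred b' \ {b'})
      (hdisj : A.G.bsucc b ∩ A.G.bsucc b' = ∅) :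
      OpStep A ⟨_, _, A.G.mergeGraph b b'⟩

/-- `A ⪰ B` : `B` can be obtained from `A`, up to isomorphism, by applying the
four `!`-box operations zero or more times. -/
def Refines (A B : BGraph) : Prop :=
  ∃ C : BGraph, Relation.ReflTransGen OpStep A C ∧ Nonempty (GIso C.G B.G)

/-- A concrete graph: a pattern graph with no `!`-vertices. -/
def IsConcrete (A : BGraph) : Prop := ∀ v : A.V, A.G.ty v ≠ .bang

/-- `B` is an instance of `A`. -/
def IsInstanceOf (B A : BGraph) : Prop := Refines A B ∧ IsConcrete B

end TGraph

namespace TGraph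

/-- Closure property shared by all `!`-boxes of a pattern graph. -/
def Clo {V E : Type} (G : TGraph V E) (X : Set V) : Prop :=
  ∀ e, ((G.ty (G.s e) = .bang ∨ G.ty (G.t e) = .wire) → G.s e ∈ X → G.t e ∈ X) ∧
    (G.ty (G.s e) = .wire → G.t e ∈ X → G.s e ∈ X)

/-- The consequences of being a pattern graph which are used on the simulating side. -/
structure Good {V E : Type} (G : TGraph V E) : Prop where
  nnn : G.NoNodeNode
  g3 : ∀ e, G.ty (G.t e) = .bang → G.ty (G.s e) = .bang
  rfl' : ∀ b, G.ty b = .bang → b ∈ G.bsucc b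
  clo : ∀ b, G.ty b = .bang → G.Clo (G.bsucc b)

/-- The consequences of being a pattern graph which are used on the simulated side. -/
structure Down {V E : Type} (G : TGraph V E) : Prop where
  g3 : ∀ e, G.ty (G.t e) = .bang → G.ty (G.s e) = .bang
  down : ∀ b e, G.ty b = .bang → G.ty (G.s e) = .bang → G.s e ∈ G.bsucc b → G.t e ∈ G.bsucc b

theorem Good.down {V E : Type} {G : TGraph V E} (hG : G.Good) {a b c : V} (ha : G.ty a = .bang)
    (hb : G.ty b = .bang) (hab : b ∈ G.bsucc a) (hbc : c ∈ G.bsucc b) : c ∈ G.bsucc a := by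
  obtain ⟨e, rfl, rfl⟩ := hbc
  exact (hG.clo a ha e).1 (Or.inl hb) hab

theorem Down.down' {V E : Type} {G : TGraph V E} (hG : G.Down) {a b c : V} (ha : G.ty a = .bang)
    (hb : G.ty b = .bang) (hab : b ∈ G.bsucc a) (hbc : c ∈ G.bsucc b) : c ∈ G.bsucc a := by
  obtain ⟨e, rfl, rfl⟩ := hbc
  exact hG.down a e ha hb hab

theorem IsPattern.down {V E : Type} {G : TGraph V E} (h : G.IsPattern) : G.Down := by
  obtain ⟨⟨_, h2⟩, _, _, _, h4⟩ := h
  exact ⟨h2, fun b e hb hs hm => h4 b _ hb hs hm ⟨e, rfl, rfl⟩⟩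

theorem IsPattern.good {V E : Type} {G : TGraph V E} (h : G.IsPattern) : G.Good := by
  obtain ⟨⟨h1, h2⟩, ⟨_, hs⟩, ⟨_, hr, _, _⟩, ho, h4⟩ := h
  refine ⟨h1, h2, hr, fun b hb e => ⟨?_, ?_⟩⟩
  · intro hty hm
    by_cases hsb : G.ty (G.s e) = .bang
    · exact h4 b _ hb hsb hm ⟨e, rfl, rfl⟩
    · have hw := hty.resolve_left hsb
      by_contra hn
      have hin := (ho b hb).1 (G.t e) ⟨⟨trivial, hn⟩, hw, ?_⟩
      · exact hsb (hin.2.2 e trivial rfl)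
      · rintro e' ⟨_, hs', _⟩ he'
        by_contra hb'
        have : e' = e := (hs _ hw).1 e' e ⟨hb', by rw [he', hw]; simp⟩ ⟨hsb, by rw [hw]; simp⟩ he' rfl
        subst this
        exact hs' hm
  · intro hw hm
    by_contra hn
    have hsb : ∀ e', G.s e' = G.s e → e' ∈ G.sigmaEdges := by
      intro e' he'
      have : G.ty (G.s e') ≠ .bang := by rw [he', hw]; simp
      exact ⟨this, fun h => this (h2 _ h)⟩
    have hout := (ho b hb).2 (G.s e) ⟨⟨trivial, hn⟩, hw, ?_⟩
    · exact hout.2.2 e trivial rfl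
    · rintro e' ⟨_, _, ht'⟩ he'
      have : e' = e := (hs _ hw).2 e' e (hsb _ he') (hsb _ rfl) he' rfl
      subst this
      exact ht' hm

open Classical in
/-- Embedding of the second copy. -/
noncomputable def pembed {V : Type} (S : Set V) (v : V) : V ⊕ {w : V // w ∈ S} :=
  if h : v ∈ S then Sum.inr ⟨v, h⟩ else Sum.inl v

theorem pembed_mem {V : Type} {S : Set V} {v : V} (h : v ∈ S) :
    pembed S v = Sum.inr ⟨v, h⟩ := by simp [pembed, h]

theorem pembed_not {V : Type} {S : Set V} {v : V} (h : v ∉ S) :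
    pembed S v = Sum.inl v := by simp [pembed, h]

theorem pembed_inl {V : Type} {S : Set V} {v w : V} :
    pembed S v = Sum.inl w ↔ v = w ∧ v ∉ S := by
  by_cases h : v ∈ S <;> simp [pembed, h]

theorem pembed_inr {V : Type} {S : Set V} {v : V} {w : {w : V // w ∈ S}} :
    pembed S v = Sum.inr w ↔ v = w.1 := by
  obtain ⟨w, hw⟩ := w
  by_cases h : v ∈ S
  · simp [pembed, h]
  · simp only [pembed, h]
    simp
    rintro rfl; exact h hw

/-- Forget which copy a vertex lies in. -/
def pproj {V : Type} {S : Set V} : V ⊕ {w : V // w ∈ S} → V := Sum.elim id Subtype.val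

theorem pproj_pembed {V : Type} {S : Set V} (v : V) : pproj (pembed S v) = v := by
  by_cases h : v ∈ S <;> simp [pembed, h, pproj]

theorem pembed_inj {V : Type} {S : Set V} {v w : V} (h : pembed S v = pembed S w) : v = w := by
  rw [← pproj_pembed (S := S) v, h, pproj_pembed]

/-- Two copies of `G` glued along `G∖S`. -/
noncomputable def pcopy {V E : Type} (G : TGraph V E) (S : Set V) :
    TGraph (V ⊕ {w : V // w ∈ S}) (E ⊕ {e : E // G.s e ∈ S ∨ G.t e ∈ S}) where
  s := Sum.elim (fun e => Sum.inl (G.s e)) (fun e => pembed S (G.s e.1))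
  t := Sum.elim (fun e => Sum.inl (G.t e)) (fun e => pembed S (G.t e.1))
  ty := Sum.elim G.ty fun v => G.ty v.1

theorem copyGraph_eq {V E : Type} (G : TGraph V E) (b : V) :
    G.copyGraph b = G.pcopy (G.bsucc b) := rfl

theorem pcopy_ty {V E : Type} (G : TGraph V E) (S : Set V) (v) :
    (G.pcopy S).ty v = G.ty (pproj v) := by
  cases v <;> rfl

theorem pcopy_ty_embed {V E : Type} (G : TGraph V E) (S : Set V) (v) :
    (G.pcopy S).ty (pembed S v) = G.ty v := by
  rw [pcopy_ty, pproj_pembed]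

section
variable {V E : Type} {G : TGraph V E} {S : Set V}

theorem bsucc_ll {g x : V} : (Sum.inl x) ∈ (G.pcopy S).bsucc (Sum.inl g) ↔ x ∈ G.bsucc g := by
  constructor
  · rintro ⟨e | e, hs, ht⟩
    · exact ⟨e, Sum.inl_injective hs, Sum.inl_injective ht⟩
    · exact ⟨e.1, (pembed_inl.1 hs).1, (pembed_inl.1 ht).1⟩
  · rintro ⟨e, hs, ht⟩
    exact ⟨Sum.inl e, congrArg Sum.inl hs, congrArg Sum.inl ht⟩

theorem bsucc_lr {g : V} {x} :
    (Sum.inr x) ∈ (G.pcopy S).bsucc (Sum.inl g) ↔ x.1 ∈ G.bsucc g ∧ g ∉ S := by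
  constructor
  · rintro ⟨e | e, hs, ht⟩
    · cases ht
    · obtain ⟨h1, h2⟩ := pembed_inl.1 hs
      exact ⟨⟨e.1, h1, pembed_inr.1 ht⟩, h1 ▸ h2⟩
  · rintro ⟨⟨e, hs, ht⟩, hg⟩
    exact ⟨Sum.inr ⟨e, Or.inr (ht ▸ x.2)⟩, pembed_inl.2 ⟨hs, hs ▸ hg⟩, pembed_inr.2 ht⟩

theorem bsucc_rr {g x} :
    (Sum.inr x) ∈ (G.pcopy S).bsucc (Sum.inr g) ↔ x.1 ∈ G.bsucc g.1 := by
  constructor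
  · rintro ⟨e | e, hs, ht⟩
    · cases ht
    · exact ⟨e.1, pembed_inr.1 hs, pembed_inr.1 ht⟩
  · rintro ⟨e, hs, ht⟩
    exact ⟨Sum.inr ⟨e, Or.inr (ht ▸ x.2)⟩, pembed_inr.2 hs, pembed_inr.2 ht⟩

theorem bsucc_rl {g x} (hS : G.bsucc g.1 ⊆ S) :
    ¬ (Sum.inl x) ∈ (G.pcopy S).bsucc (Sum.inr g) := by
  rintro ⟨e | e, hs, ht⟩
  · cases hs
  · obtain ⟨h1, h2⟩ := pembed_inl.1 ht
    exact h2 (hS ⟨e.1, pembed_inr.1 hs, rfl⟩)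

theorem bsucc_proj {g x} (h : x ∈ (G.pcopy S).bsucc g) : pproj x ∈ G.bsucc (pproj g) := by
  obtain ⟨e | e, rfl, rfl⟩ := h
  · exact ⟨e, rfl, rfl⟩
  · exact ⟨e.1, (pproj_pembed _).symm, (pproj_pembed _).symm⟩

theorem bsucc_proj' {g x} (h : pembed S x ∈ (G.pcopy S).bsucc g) : x ∈ G.bsucc (pproj g) := by
  have := bsucc_proj h
  rwa [pproj_pembed] at this

theorem bsucc_embed {g x : V} (h : x ∈ G.bsucc g) (hS : g ∈ S ∨ x ∈ S) :
    pembed S x ∈ (G.pcopy S).bsucc (pembed S g) := by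
  obtain ⟨e, rfl, rfl⟩ := h
  exact ⟨Sum.inr ⟨e, hS⟩, rfl, rfl⟩

theorem Clo.sub (hS : G.Clo S) {g : V} (hg : G.ty g = .bang) (h : g ∈ S) : G.bsucc g ⊆ S := by
  rintro _ ⟨e, rfl, rfl⟩
  exact (hS e).1 (Or.inl hg) h

theorem Good.pcopy (hG : G.Good) (hS : G.Clo S) : (G.pcopy S).Good := by
  refine ⟨?_, ?_, ?_, ?_⟩
  · rintro (e | e)
    · exact hG.nnn e
    · change ¬ ((G.pcopy S).ty (pembed S _) = _ ∧ (G.pcopy S).ty (pembed S _) = _)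
      rw [pcopy_ty_embed, pcopy_ty_embed]
      exact hG.nnn e
  · rintro (e | e)
    · exact hG.g3 e
    · change (G.pcopy S).ty (pembed S _) = _ → (G.pcopy S).ty (pembed S _) = _
      rw [pcopy_ty_embed, pcopy_ty_embed]
      exact hG.g3 e
  · rintro (b | b) hb
    · exact bsucc_ll.2 (hG.rfl' _ hb)
    · exact bsucc_rr.2 (hG.rfl' _ hb)
  · rintro (b | b) hb (e | e)
    · have := hG.clo b hb e
      refine ⟨fun h1 h2 => bsucc_ll.2 (this.1 h1 (bsucc_ll.1 h2)),
        fun h1 h2 => bsucc_ll.2 (this.2 h1 (bsucc_ll.1 h2))⟩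
    · have := hG.clo b hb e
      change ((((G.pcopy S).ty (pembed S (G.s e))) = _ ∨ ((G.pcopy S).ty (pembed S (G.t e))) = _) →
        pembed S (G.s e) ∈ _ → pembed S (G.t e) ∈ _) ∧ (((G.pcopy S).ty (pembed S (G.s e))) = _ →
        pembed S (G.t e) ∈ _ → pembed S (G.s e) ∈ _)
      rw [pcopy_ty_embed, pcopy_ty_embed]
      have hb' : G.ty b = .bang := hb
      have key : ∀ x y, pembed S x ∈ (G.pcopy S).bsucc (Sum.inl b) → (x ∈ S ∨ y ∈ S) →
          y ∈ G.bsucc b → pembed S y ∈ (G.pcopy S).bsucc (Sum.inl b) := by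
        intro x y hx hxy hy
        by_cases hyS : y ∈ S
        · rw [pembed_mem hyS, bsucc_lr]
          refine ⟨hy, fun hbS => ?_⟩
          have hxb : x ∈ G.bsucc b := bsucc_proj' hx
          have hxS := hS.sub hb' hbS hxb
          rw [pembed_mem hxS, bsucc_lr] at hx
          exact hx.2 hbS
        · rw [pembed_not hyS]; exact bsucc_ll.2 hy
      constructor
      · intro h1 h2
        refine key _ _ h2 e.2 (this.1 h1 ?_)
        exact bsucc_proj' h2
      · intro h1 h2
        refine key _ _ h2 e.2.symm (this.2 h1 ?_)
        exact bsucc_proj' h2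
    · have hsub := hS.sub hb b.2
      exact ⟨fun _ h => (bsucc_rl hsub h).elim, fun _ h => (bsucc_rl hsub h).elim⟩
    · have hsub := hS.sub hb b.2
      have := hG.clo b hb e
      change ((((G.pcopy S).ty (pembed S (G.s e))) = _ ∨ ((G.pcopy S).ty (pembed S (G.t e))) = _) →
        pembed S (G.s e) ∈ _ → pembed S (G.t e) ∈ _) ∧ (((G.pcopy S).ty (pembed S (G.s e))) = _ →
        pembed S (G.t e) ∈ _ → pembed S (G.s e) ∈ _)
      rw [pcopy_ty_embed, pcopy_ty_embed]
      have key : ∀ x, pembed S x ∈ (G.pcopy S).bsucc (Sum.inr b) ↔ x ∈ G.bsucc b.1 := by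
        intro x
        constructor
        · intro h; exact bsucc_proj' h
        · intro h; rw [pembed_mem (hsub h)]; exact bsucc_rr.2 h
      rw [key, key]; exact this

theorem Down.pcopy (hG : G.Down) (hS : ∀ g, G.ty g = .bang → g ∈ S → G.bsucc g ⊆ S) :
    (G.pcopy S).Down := by
  refine ⟨?_, ?_⟩
  · rintro (e | e)
    · exact hG.g3 e
    · change (G.pcopy S).ty (pembed S _) = _ → (G.pcopy S).ty (pembed S _) = _
      rw [pcopy_ty_embed, pcopy_ty_embed]
      exact hG.g3 e
  · intro b e hb hs hm
    obtain ⟨x, hx⟩ : ∃ x, (G.pcopy S).s e = x := ⟨_, rfl⟩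
    obtain ⟨y, hy⟩ : ∃ y, (G.pcopy S).t e = y := ⟨_, rfl⟩
    have hxy : y ∈ (G.pcopy S).bsucc x := ⟨e, hx, hy⟩
    rw [hx] at hs hm
    rw [hy]
    have h1 := bsucc_proj hm
    have h2 := bsucc_proj hxy
    have hb' := hb
    rw [pcopy_ty] at hb hs
    have h3 := hG.down' hb hs h1 h2
    rcases b with b | b <;> rcases x with x | x <;> rcases y with y | y
    · exact bsucc_ll.2 h3
    · exact bsucc_lr.2 ⟨h3, fun h => (bsucc_lr.1 hxy).2 (hS _ hb h h1)⟩
    · exact bsucc_ll.2 h3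
    · exact bsucc_lr.2 ⟨h3, (bsucc_lr.1 hm).2⟩
    · exact (bsucc_rl (hS _ hb b.2) hm).elim
    · exact bsucc_rr.2 h3
    · exact (bsucc_rl (hS _ hs x.2) hxy).elim
    · exact bsucc_rr.2 h3

theorem bsucc_restrict {X : Set V} {g x} :
    x ∈ (G.restrict X).bsucc g ↔ x.1 ∈ G.bsucc g.1 := by
  constructor
  · rintro ⟨e, rfl, rfl⟩
    exact ⟨e.1, rfl, rfl⟩
  · rintro ⟨e, hs, ht⟩
    exact ⟨⟨e, hs ▸ g.2, ht ▸ x.2⟩, Subtype.ext hs, Subtype.ext ht⟩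

theorem Good.restrict (hG : G.Good) (X : Set V) : (G.restrict X).Good := by
  refine ⟨fun e => hG.nnn e.1, fun e => hG.g3 e.1, fun b hb => bsucc_restrict.2 (hG.rfl' _ hb), ?_⟩
  intro b hb e
  rw [bsucc_restrict, bsucc_restrict]
  exact hG.clo b.1 hb e.1

theorem Down.restrict (hG : G.Down) (X : Set V) : (G.restrict X).Down := by
  refine ⟨fun e => hG.g3 e.1, ?_⟩
  intro b e hb hs
  rw [bsucc_restrict, bsucc_restrict]
  exact hG.down b.1 e.1 hb hs

end

/-! Isomorphisms -/

section
variable {V E V' E' V'' E'' : Type} {G : TGraph V E} {H : TGraph V' E'} {K : TGraph V'' E''}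

def GIso.refl (G : TGraph V E) : GIso G G :=
  ⟨GHom.id G, Function.bijective_id, Function.bijective_id⟩

def GIso.trans (f : GIso G H) (g : GIso H K) : GIso G K :=
  ⟨g.toHom.comp f.toHom, g.fv_bij.comp f.fv_bij, g.fe_bij.comp f.fe_bij⟩

theorem GIso.bsucc_iff (f : GIso G H) {b v : V} :
    f.toHom.fv v ∈ H.bsucc (f.toHom.fv b) ↔ v ∈ G.bsucc b := by
  refine ⟨?_, f.toHom.mem_bsucc⟩
  rintro ⟨e, hs, ht⟩
  obtain ⟨e, rfl⟩ := f.fe_bij.2 e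
  rw [f.toHom.map_s] at hs
  rw [f.toHom.map_t] at ht
  exact ⟨e, f.fv_bij.1 hs, f.fv_bij.1 ht⟩

theorem GIso.restrict (f : GIso G H) {X : Set V} {Y : Set V'}
    (h : ∀ v, f.toHom.fv v ∈ Y ↔ v ∈ X) : Nonempty (GIso (G.restrict X) (H.restrict Y)) := by
  refine ⟨⟨⟨fun v => ⟨f.toHom.fv v.1, (h _).2 v.2⟩,
    fun e => ⟨f.toHom.fe e.1, by rw [f.toHom.map_s]; exact (h _).2 e.2.1,
      by rw [f.toHom.map_t]; exact (h _).2 e.2.2⟩, fun e => Subtype.ext (f.toHom.map_s _),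
      fun e => Subtype.ext (f.toHom.map_t _), fun v => f.toHom.map_ty _⟩, ⟨?_, ?_⟩, ⟨?_, ?_⟩⟩⟩
  · intro v w hvw
    exact Subtype.ext (f.fv_bij.1 (congrArg Subtype.val hvw))
  · rintro ⟨w, hw⟩
    obtain ⟨v, rfl⟩ := f.fv_bij.2 w
    exact ⟨⟨v, (h _).1 hw⟩, rfl⟩
  · intro v w hvw
    exact Subtype.ext (f.fe_bij.1 (congrArg Subtype.val hvw))
  · rintro ⟨w, hw⟩
    obtain ⟨e, rfl⟩ := f.fe_bij.2 w
    rw [f.toHom.map_s, f.toHom.map_t, h, h] at hw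
    exact ⟨⟨e, hw⟩, rfl⟩

theorem GIso.pcopy (f : GIso G H) {X : Set V} {Y : Set V'}
    (h : ∀ v, f.toHom.fv v ∈ Y ↔ v ∈ X) : Nonempty (GIso (G.pcopy X) (H.pcopy Y)) := by
  have hemb : ∀ v, pembed Y (f.toHom.fv v) =
      Sum.map f.toHom.fv (fun v : {v // v ∈ X} => (⟨f.toHom.fv v.1, (h _).2 v.2⟩ : {v // v ∈ Y}))
        (pembed X v) := by
    intro v
    by_cases hv : v ∈ X
    · rw [pembed_mem hv, pembed_mem ((h _).2 hv)]; rfl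
    · rw [pembed_not hv, pembed_not (fun h' => hv ((h _).1 h'))]; rfl
  refine ⟨⟨⟨Sum.map f.toHom.fv (fun v => ⟨f.toHom.fv v.1, (h _).2 v.2⟩),
    Sum.map f.toHom.fe (fun e => ⟨f.toHom.fe e.1, by
      rw [f.toHom.map_s, f.toHom.map_t, h, h]; exact e.2⟩), ?_, ?_, ?_⟩, ?_, ?_⟩⟩
  · rintro (e | e)
    · exact congrArg Sum.inl (f.toHom.map_s e)
    · exact (congrArg (pembed Y) (f.toHom.map_s e.1)).trans (hemb _)
  · rintro (e | e)
    · exact congrArg Sum.inl (f.toHom.map_t e)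
    · exact (congrArg (pembed Y) (f.toHom.map_t e.1)).trans (hemb _)
  · rintro (e | e)
    · exact f.toHom.map_ty e
    · exact f.toHom.map_ty e.1
  · refine Sum.map_bijective.2 ⟨f.fv_bij, ?_, ?_⟩
    · intro v w hvw
      exact Subtype.ext (f.fv_bij.1 (congrArg Subtype.val hvw))
    · rintro ⟨w, hw⟩
      obtain ⟨v, rfl⟩ := f.fv_bij.2 w
      exact ⟨⟨v, (h _).1 hw⟩, rfl⟩
  · refine Sum.map_bijective.2 ⟨f.fe_bij, ?_, ?_⟩
    · intro v w hvw
      exact Subtype.ext (f.fe_bij.1 (congrArg Subtype.val hvw))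
    · rintro ⟨w, hw⟩
      obtain ⟨e, rfl⟩ := f.fe_bij.2 w
      rw [f.toHom.map_s, f.toHom.map_t, h, h] at hw
      exact ⟨⟨e, hw⟩, rfl⟩

theorem iso_restrict_restrict {X : Set V} {Y : Set {v // v ∈ X}} {Z : Set V}
    (h : ∀ v, v ∈ Z ↔ ∃ hv : v ∈ X, (⟨v, hv⟩ : {v // v ∈ X}) ∈ Y) :
    Nonempty (GIso ((G.restrict X).restrict Y) (G.restrict Z)) := by
  refine ⟨⟨⟨fun v => ⟨v.1.1, (h _).2 ⟨v.1.2, v.2⟩⟩,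
    fun e => ⟨e.1.1, (h _).2 ⟨_, e.2.1⟩, (h _).2 ⟨_, e.2.2⟩⟩,
    fun _ => rfl, fun _ => rfl, fun _ => rfl⟩, ⟨?_, ?_⟩, ⟨?_, ?_⟩⟩⟩
  · intro v w hvw
    have h' : v.1.1 = w.1.1 := Subtype.mk.inj hvw
    exact Subtype.ext (Subtype.ext h')
  · rintro ⟨w, hw⟩
    obtain ⟨h1, h2⟩ := (h _).1 hw
    exact ⟨⟨⟨w, h1⟩, h2⟩, rfl⟩
  · intro v w hvw
    have h' : v.1.1 = w.1.1 := Subtype.mk.inj hvw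
    exact Subtype.ext (Subtype.ext h')
  · rintro ⟨e, he1, he2⟩
    obtain ⟨h1, h2⟩ := (h _).1 he1
    obtain ⟨h3, h4⟩ := (h _).1 he2
    exact ⟨⟨⟨e, h1, h3⟩, h2, h4⟩, rfl⟩

theorem iso_restrict_univ {X : Set V} (h : ∀ v, v ∈ X) : Nonempty (GIso G (G.restrict X)) := by
  refine ⟨⟨⟨fun v => ⟨v, h v⟩, fun e => ⟨e, h _, h _⟩,
    fun _ => rfl, fun _ => rfl, fun _ => rfl⟩, ⟨?_, ?_⟩, ⟨?_, ?_⟩⟩⟩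
  · intro v w hvw
    exact congrArg Subtype.val hvw
  · rintro ⟨w, hw⟩
    exact ⟨w, rfl⟩
  · intro v w hvw
    exact congrArg Subtype.val hvw
  · rintro ⟨e, he⟩
    exact ⟨e, rfl⟩

theorem iso_pcopy_empty {X : Set V} (h : ∀ v, v ∉ X) : Nonempty (GIso G (G.pcopy X)) := by
  refine ⟨⟨⟨Sum.inl, Sum.inl,
    fun _ => rfl, fun _ => rfl, fun _ => rfl⟩, ⟨Sum.inl_injective, ?_⟩, ⟨Sum.inl_injective, ?_⟩⟩⟩
  · rintro (w | w)
    · exact ⟨w, rfl⟩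
    · exact (h _ w.2).elim
  · rintro (w | w)
    · exact ⟨w, rfl⟩
    · exact (w.2.elim (h _) (h _)).elim

theorem Clo.no_edge (hG : G.Good) {S B : Set V} (hS : G.Clo S) (hB : G.Clo B)
    (hd : ∀ v, v ∈ S → v ∈ B → False) (e : E) : ¬ (G.s e ∈ S ∧ G.t e ∈ B) := by
  rintro ⟨h1, h2⟩
  have a := hS e
  have b := hB e
  have n := hG.nnn e
  have g := hG.g3 e
  rcases hs : G.ty (G.s e) with _ | _ | _
  · rcases ht : G.ty (G.t e) with _ | _ | _
    · exact n ⟨hs, ht⟩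
    · exact hd _ (a.1 (Or.inr ht) h1) h2
    · rw [g ht] at hs; cases hs
  · exact hd _ h1 (b.2 hs h2)
  · exact hd _ (a.1 (Or.inl hs) h1) h2

theorem iso_pcopy_pcopy (hG : G.Good) {S : Set V} {g : V} (hg : G.ty g = .bang) (hS : G.Clo S)
    (hd : ∀ v, v ∈ S → v ∈ G.bsucc g → False) {Z : Set V}
    (hZ : ∀ v, v ∈ Z ↔ v ∈ S ∨ v ∈ G.bsucc g) :
    Nonempty (GIso ((G.pcopy S).copyGraph (Sum.inl g)) (G.pcopy Z)) := by
  have hcl := hG.clo g hg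
  have hgS : g ∉ S := fun h => hd g h (hG.rfl' g hg)
  rw [copyGraph_eq]
  set B := (G.pcopy S).bsucc (Sum.inl g) with hB
  have hl : ∀ x, Sum.inl x ∈ B ↔ x ∈ G.bsucc g := fun x => bsucc_ll
  have hr : ∀ x, Sum.inr x ∉ B := fun x h => hd _ x.2 (bsucc_lr.1 h).1
  have hBp : ∀ x, x ∈ B → pproj x ∈ Z := fun x h => (hZ _).2 (Or.inr (bsucc_proj h))
  have hse : ∀ e, ((G.pcopy S).s e ∈ B ∨ (G.pcopy S).t e ∈ B) →
      ∃ e', e = Sum.inl e' ∧ (G.s e' ∈ G.bsucc g ∨ G.t e' ∈ G.bsucc g) := by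
    rintro (e | e) he
    · exact ⟨e, rfl, he.imp (hl _).1 (hl _).1⟩
    · exfalso
      rcases he with he | he
      · change pembed S (G.s e) ∈ B at he
        by_cases h : G.s e ∈ S
        · rw [pembed_mem h] at he; exact hr _ he
        · rw [pembed_not h, hl] at he
          exact Clo.no_edge hG hcl hS (fun v a b => hd v b a) e.1 ⟨he, e.2.resolve_left h⟩
      · change pembed S (G.t e) ∈ B at he
        by_cases h : G.t e ∈ S
        · rw [pembed_mem h] at he; exact hr _ he
        · rw [pembed_not h, hl] at he
          exact Clo.no_edge hG hS hcl hd e.1 ⟨e.2.resolve_right h, he⟩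
  let fv : (V ⊕ {w : V // w ∈ S}) ⊕ {w // w ∈ B} → V ⊕ {w : V // w ∈ Z} :=
    Sum.elim (Sum.elim Sum.inl (fun v => Sum.inr ⟨v.1, (hZ _).2 (Or.inl v.2)⟩))
      (fun v => Sum.inr ⟨pproj v.1, hBp _ v.2⟩)
  have hpe : ∀ e : {e // (G.pcopy S).s e ∈ B ∨ (G.pcopy S).t e ∈ B},
      G.s (Sum.elim id Subtype.val e.1) ∈ Z ∨ G.t (Sum.elim id Subtype.val e.1) ∈ Z := by
    rintro ⟨e, he⟩
    obtain ⟨e', rfl, h⟩ := hse e he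
    exact h.imp (fun h => (hZ _).2 (Or.inr h)) (fun h => (hZ _).2 (Or.inr h))
  let fe : (E ⊕ {e : E // G.s e ∈ S ∨ G.t e ∈ S}) ⊕
      {e // (G.pcopy S).s e ∈ B ∨ (G.pcopy S).t e ∈ B} → E ⊕ {e : E // G.s e ∈ Z ∨ G.t e ∈ Z} :=
    Sum.elim (Sum.elim Sum.inl (fun e => Sum.inr ⟨e.1, e.2.imp (fun h => (hZ _).2 (Or.inl h))
        (fun h => (hZ _).2 (Or.inl h))⟩))
      (fun e => Sum.inr ⟨Sum.elim id Subtype.val e.1, hpe e⟩)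
  have k1 : ∀ x, x ∉ G.bsucc g → fv (Sum.inl (pembed S x)) = pembed Z x := by
    intro x hx
    by_cases h : x ∈ S
    · rw [pembed_mem h, pembed_mem ((hZ _).2 (Or.inl h))]; rfl
    · rw [pembed_not h, pembed_not (by rw [hZ]; tauto)]; rfl
  have k2 : ∀ x, x ∉ S → fv (pembed B (Sum.inl x)) = pembed Z x := by
    intro x hx
    by_cases h : x ∈ G.bsucc g
    · rw [pembed_mem ((hl _).2 h), pembed_mem ((hZ _).2 (Or.inr h))]; rfl
    · rw [pembed_not (by rwa [hl]), pembed_not (by rw [hZ]; tauto)]; rfl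
  have n1 := Clo.no_edge hG hS hcl hd
  have n2 := Clo.no_edge hG hcl hS (fun v a b => hd v b a)
  refine ⟨⟨⟨fv, fe, ?_, ?_, ?_⟩, ⟨?_, ?_⟩, ⟨?_, ?_⟩⟩⟩
  · rintro ((e | e) | ⟨e, he⟩)
    · rfl
    · refine (k1 _ fun h => ?_).symm
      rcases e.2 with h' | h'
      · exact hd _ h' h
      · exact n2 _ ⟨h, h'⟩
    · obtain ⟨e', rfl, h⟩ := hse e he
      refine (k2 _ fun h' => ?_).symm
      rcases h with h | h
      · exact hd _ h' h
      · exact n1 _ ⟨h', h⟩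
  · rintro ((e | e) | ⟨e, he⟩)
    · rfl
    · refine (k1 _ fun h => ?_).symm
      rcases e.2 with h' | h'
      · exact n1 _ ⟨h', h⟩
      · exact hd _ h' h
    · obtain ⟨e', rfl, h⟩ := hse e he
      refine (k2 _ fun h' => ?_).symm
      rcases h with h | h
      · exact n2 _ ⟨h, h'⟩
      · exact hd _ h' h
  · rintro ((e | e) | ⟨e | e, he⟩) <;> rfl
  · rintro ((v | v) | ⟨v | v, hv⟩) ((w | w) | ⟨w | w, hw⟩) h
    all_goals first
      | exact (hr _ hv).elim
      | exact (hr _ hw).elim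
      | (cases h; done)
      | skip
    · cases h; rfl
    · have := congrArg Subtype.val (Sum.inr_injective h)
      exact congrArg (Sum.inl ∘ Sum.inr) (Subtype.ext this)
    · have : v.1 = w := congrArg Subtype.val (Sum.inr_injective h)
      exact (hd _ v.2 (this ▸ (hl _).1 hw)).elim
    · have : v = w.1 := congrArg Subtype.val (Sum.inr_injective h)
      exact (hd _ w.2 (this ▸ (hl _).1 hv)).elim
    · have : v = w := congrArg Subtype.val (Sum.inr_injective h)
      subst this; rfl
  · rintro (v | ⟨v, hv⟩)
    · exact ⟨Sum.inl (Sum.inl v), rfl⟩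
    · rcases (hZ _).1 hv with h | h
      · exact ⟨Sum.inl (Sum.inr ⟨v, h⟩), rfl⟩
      · exact ⟨Sum.inr ⟨Sum.inl v, (hl _).2 h⟩, rfl⟩
  · have nn : ∀ e : E, (G.s e ∈ S ∨ G.t e ∈ S) → (G.s e ∈ G.bsucc g ∨ G.t e ∈ G.bsucc g) → False := by
      rintro e (h | h) (h' | h')
      · exact hd _ h h'
      · exact n1 _ ⟨h, h'⟩
      · exact n2 _ ⟨h', h⟩
      · exact hd _ h h'
    rintro ((v | v) | ⟨v, hv⟩) ((w | w) | ⟨w, hw⟩) h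
    all_goals try (obtain ⟨v, rfl, hv'⟩ := hse v hv)
    all_goals try (obtain ⟨w, rfl, hw'⟩ := hse w hw)
    all_goals first
      | (cases h; done)
      | skip
    · cases h; rfl
    · have := congrArg Subtype.val (Sum.inr_injective h)
      exact congrArg (Sum.inl ∘ Sum.inr) (Subtype.ext this)
    · have : v.1 = w := congrArg Subtype.val (Sum.inr_injective h)
      exact (nn _ v.2 (this ▸ hw')).elim
    · have : v = w.1 := congrArg Subtype.val (Sum.inr_injective h)
      exact (nn _ w.2 (this ▸ hv')).elim
    · have : v = w := congrArg Subtype.val (Sum.inr_injective h)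
      subst this; rfl
  · rintro (v | ⟨v, hv⟩)
    · exact ⟨Sum.inl (Sum.inl v), rfl⟩
    · by_cases h : G.s v ∈ S ∨ G.t v ∈ S
      · exact ⟨Sum.inl (Sum.inr ⟨v, h⟩), rfl⟩
      · refine ⟨Sum.inr ⟨Sum.inl v, ?_⟩, rfl⟩
        rw [hZ, hZ] at hv
        change Sum.inl (G.s v) ∈ B ∨ Sum.inl (G.t v) ∈ B
        rw [hl, hl]
        tauto

end

/-- The operations other than `MERGE`. -/
inductive Op3 : BGraph → BGraph → Prop
  | copy (A : BGraph) (b : A.V) (hb : A.G.ty b = .bang) : Op3 A ⟨_, _, A.G.copyGraph b⟩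
  | drop (A : BGraph) (b : A.V) (hb : A.G.ty b = .bang) : Op3 A ⟨_, _, A.G.dropGraph b⟩
  | kill (A : BGraph) (b : A.V) (hb : A.G.ty b = .bang) : Op3 A ⟨_, _, A.G.killGraph b⟩

theorem Op3.step {A B : BGraph} (h : Op3 A B) : OpStep A B := by
  cases h with
  | copy b hb => exact OpStep.copy A b hb
  | drop b hb => exact OpStep.drop A b hb
  | kill b hb => exact OpStep.kill A b hb

/-- Reachability up to isomorphism, not using `MERGE`. -/
def Reach (A B : BGraph) : Prop :=
  ∃ C : BGraph, Relation.ReflTransGen Op3 A C ∧ Nonempty (GIso C.G B.G)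

theorem Op3.iso {A B A' : BGraph} (h : Op3 A B) (i : Nonempty (GIso A.G A'.G)) :
    ∃ B', Op3 A' B' ∧ Nonempty (GIso B.G B'.G) := by
  obtain ⟨i⟩ := i
  cases h with
  | copy b hb =>
    refine ⟨_, Op3.copy A' (i.toHom.fv b) (by rw [i.toHom.map_ty]; exact hb), ?_⟩
    exact i.pcopy fun v => i.bsucc_iff
  | drop b hb =>
    refine ⟨_, Op3.drop A' (i.toHom.fv b) (by rw [i.toHom.map_ty]; exact hb), ?_⟩
    exact i.restrict fun v => not_congr i.fv_bij.1.eq_iff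
  | kill b hb =>
    refine ⟨_, Op3.kill A' (i.toHom.fv b) (by rw [i.toHom.map_ty]; exact hb), ?_⟩
    exact i.restrict fun v => not_congr i.bsucc_iff

theorem reach_iso {A B : BGraph} (h : Relation.ReflTransGen Op3 A B) :
    ∀ A' : BGraph, Nonempty (GIso A.G A'.G) →
      ∃ B', Relation.ReflTransGen Op3 A' B' ∧ Nonempty (GIso B.G B'.G) := by
  intro A' i
  induction h with
  | refl => exact ⟨A', .refl, i⟩
  | tail _ h2 ih =>
    obtain ⟨C, h3, h4⟩ := ih
    obtain ⟨D, h5, h6⟩ := h2.iso h4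
    exact ⟨D, h3.tail h5, h6⟩

noncomputable def GIso.symm {V E V' E' : Type} {G : TGraph V E} {H : TGraph V' E'} (f : GIso G H) :
    GIso H G := by
  let ev := Equiv.ofBijective _ f.fv_bij
  let ee := Equiv.ofBijective _ f.fe_bij
  have h1 : ∀ w, f.toHom.fv (ev.symm w) = w := ev.apply_symm_apply
  have h2 : ∀ w, f.toHom.fe (ee.symm w) = w := ee.apply_symm_apply
  refine ⟨⟨ev.symm, ee.symm, ?_, ?_, ?_⟩, ev.symm.bijective, ee.symm.bijective⟩
  · intro e
    apply f.fv_bij.1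
    rw [← f.toHom.map_s, h1, h2]
  · intro e
    apply f.fv_bij.1
    rw [← f.toHom.map_t, h1, h2]
  · intro v
    rw [← f.toHom.map_ty, h1]

theorem Reach.trans {A B C : BGraph} (h : Reach A B) (h' : Reach B C) : Reach A C := by
  obtain ⟨X, hX, ⟨i⟩⟩ := h
  obtain ⟨Y, hY, ⟨j⟩⟩ := h'
  obtain ⟨Z, hZ, ⟨k⟩⟩ := reach_iso hY X ⟨i.symm⟩
  exact ⟨Z, hX.trans hZ, ⟨k.symm.trans j⟩⟩

theorem Reach.rfl {A : BGraph} : Reach A A := ⟨A, .refl, ⟨GIso.refl _⟩⟩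

theorem Reach.of_iso {A B : BGraph} (h : Nonempty (GIso A.G B.G)) : Reach A B := ⟨A, .refl, h⟩

theorem Reach.of_op {A B : BGraph} (h : Op3 A B) : Reach A B := ⟨B, .single h, ⟨GIso.refl _⟩⟩

section
variable {V E : Type} {G : TGraph V E}

/-- Union of the boxes of a set of vertices. -/
def boxes (G : TGraph V E) (F : Set V) : Set V := {v | ∃ g ∈ F, v ∈ G.bsucc g}

theorem Good.clo_boxes (hG : G.Good) {F : Set V} (hF : ∀ g ∈ F, G.ty g = .bang) :
    G.Clo (G.boxes F) := by
  intro e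
  constructor
  · rintro h ⟨g, hg, hm⟩
    exact ⟨g, hg, (hG.clo g (hF g hg) e).1 h hm⟩
  · rintro h ⟨g, hg, hm⟩
    exact ⟨g, hg, (hG.clo g (hF g hg) e).2 h hm⟩

theorem reach_copy (hG : G.Good) {F : Set V} (hfin : F.Finite) :
    (∀ g ∈ F, G.ty g = .bang) →
    (∀ g₁ ∈ F, ∀ g₂ ∈ F, g₁ ≠ g₂ → ∀ v, v ∈ G.bsucc g₁ → v ∈ G.bsucc g₂ → False) →
    Reach ⟨_, _, G⟩ ⟨_, _, G.pcopy (G.boxes F)⟩ := by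
  induction F, hfin using Set.Finite.induction_on with
  | empty =>
    intro _ _
    exact Reach.of_iso (iso_pcopy_empty (by rintro v ⟨g, hg, _⟩; exact hg))
  | @insert g F hgF _ ih =>
    intro h1 h2
    have hF : ∀ g ∈ F, G.ty g = .bang := fun g hg => h1 g (Or.inr hg)
    refine (ih hF (fun a ha b hb => h2 a (Or.inr ha) b (Or.inr hb))).trans ?_
    have hg := h1 g (Or.inl rfl)
    refine (Reach.of_op (Op3.copy ⟨_, _, G.pcopy (G.boxes F)⟩ (Sum.inl g) hg)).trans ?_
    refine Reach.of_iso (iso_pcopy_pcopy hG hg (hG.clo_boxes hF) ?_ ?_)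
    · rintro v ⟨a, ha, hv⟩ hv'
      exact h2 a (Or.inr ha) g (Or.inl rfl) (by rintro rfl; exact hgF ha) v hv hv'
    · intro v
      constructor
      · rintro ⟨a, rfl | ha, hv⟩
        · exact Or.inr hv
        · exact Or.inl ⟨a, ha, hv⟩
      · rintro (⟨a, ha, hv⟩ | hv)
        · exact ⟨a, Or.inr ha, hv⟩
        · exact ⟨g, Or.inl rfl, hv⟩

theorem reach_kill (hG : G.Good) {F : Set V} (hfin : F.Finite) :
    (∀ g ∈ F, G.ty g = .bang) →
    Reach ⟨_, _, G⟩ ⟨_, _, G.restrict (G.boxes F)ᶜ⟩ := by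
  induction F, hfin using Set.Finite.induction_on with
  | empty =>
    intro _
    exact Reach.of_iso (iso_restrict_univ (by rintro v ⟨g, hg, _⟩; exact hg))
  | @insert g F hgF _ ih =>
    intro h1
    have hF : ∀ g ∈ F, G.ty g = .bang := fun g hg => h1 g (Or.inr hg)
    have hg := h1 g (Or.inl rfl)
    have hins : ∀ v, v ∈ G.boxes (insert g F) ↔ v ∈ G.boxes F ∨ v ∈ G.bsucc g := by
      intro v
      constructor
      · rintro ⟨a, rfl | ha, hv⟩
        · exact Or.inr hv
        · exact Or.inl ⟨a, ha, hv⟩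
      · rintro (⟨a, ha, hv⟩ | hv)
        · exact ⟨a, Or.inr ha, hv⟩
        · exact ⟨g, Or.inl rfl, hv⟩
    by_cases hm : g ∈ G.boxes F
    · have : G.boxes (insert g F) = G.boxes F := by
        ext v
        rw [hins]
        constructor
        · rintro (h | h)
          · exact h
          · exact (hG.clo_boxes hF).sub hg hm h
        · exact Or.inl
      rw [this]
      exact ih hF
    · refine (ih hF).trans ?_
      refine (Reach.of_op (Op3.kill ⟨_, _, G.restrict (G.boxes F)ᶜ⟩ ⟨g, hm⟩ hg)).trans ?_
      refine Reach.of_iso (iso_restrict_restrict ?_)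
      intro v
      change (¬ v ∈ _) ↔ ∃ h : v ∉ _, ¬ (_ ∈ _)
      rw [hins]
      simp only [bsucc_restrict]
      simp

theorem reach_drop {F : Set V} (hfin : F.Finite) :
    (∀ g ∈ F, G.ty g = .bang) →
    Reach ⟨_, _, G⟩ ⟨_, _, G.restrict Fᶜ⟩ := by
  induction F, hfin using Set.Finite.induction_on with
  | empty =>
    intro _
    exact Reach.of_iso (iso_restrict_univ (by rintro v hv; exact hv))
  | @insert g F hgF _ ih =>
    intro h1
    have hF : ∀ g ∈ F, G.ty g = .bang := fun g hg => h1 g (Or.inr hg)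
    have hg := h1 g (Or.inl rfl)
    refine (ih hF).trans ?_
    refine (Reach.of_op (Op3.drop ⟨_, _, G.restrict Fᶜ⟩ ⟨g, hgF⟩ hg)).trans ?_
    refine Reach.of_iso (iso_restrict_restrict ?_)
    intro v
    change (¬ (v = g ∨ v ∈ F)) ↔ ∃ h : v ∉ F, ¬ ((⟨v, h⟩ : {v // v ∈ Fᶜ}) = ⟨g, hgF⟩)
    simp only [Subtype.mk.injEq, exists_prop]
    tauto

end

/-- The simulation: `G` has the same string-graph part as `H`, and the box of each `!`-vertex
of `H` is (on the string-graph part) the disjoint union of the boxes in a finite fibre. -/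
structure Sim {V E V' E' : Type} (G : TGraph V E) (H : TGraph V' E') where
  f : V → V'
  r : E → E' → Prop
  good : G.Good
  down : H.Down
  ty : ∀ v, H.ty (f v) = G.ty v
  inj : ∀ v v', G.ty v ≠ .bang → f v = f v' → v = v'
  surj : ∀ w, H.ty w ≠ .bang → ∃ v, f v = w
  rs : ∀ e e', r e e' → f (G.s e) = H.s e'
  rt : ∀ e e', r e e' → f (G.t e) = H.t e'
  rsig : ∀ e e', r e e' → e' ∈ H.sigmaEdges
  tot : ∀ e, e ∈ G.sigmaEdges → ∃ e', r e e'
  un : ∀ e e₁ e₂, r e e₁ → r e e₂ → e₁ = e₂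
  tot' : ∀ e', e' ∈ H.sigmaEdges → ∃ e, r e e'
  un' : ∀ e₁ e₂ e', r e₁ e' → r e₂ e' → e₁ = e₂
  lift : ∀ v h, H.ty h = .bang → f v ∈ H.bsucc h → ∃ g, f g = h ∧ v ∈ G.bsucc g
  push : ∀ v g, G.ty v ≠ .bang → G.ty g = .bang → v ∈ G.bsucc g → f v ∈ H.bsucc (f g)
  disj : ∀ g₁ g₂, G.ty g₁ = .bang → f g₁ = f g₂ → g₁ ≠ g₂ →
    ∀ v, v ∈ G.bsucc g₁ → v ∈ G.bsucc g₂ → False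
  fin : ∀ h, H.ty h = .bang → {g | f g = h}.Finite
  finT : {c | G.ty c = .bang ∧ ∃ g, G.ty g = .bang ∧ c ∈ G.bsucc g ∧
    f c ∉ H.bsucc (f g)}.Finite

namespace Sim
variable {V E V' E' : Type} {G : TGraph V E} {H : TGraph V' E'}

theorem sig (σ : Sim G H) {e e'} (h : σ.r e e') : e ∈ G.sigmaEdges := by
  have := σ.rsig e e' h
  unfold sigmaEdges at *
  rw [Set.mem_ofPred_eq, ← σ.rs e e' h, ← σ.rt e e' h, σ.ty, σ.ty] at this
  exact this

/-- Restricting both sides. -/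
def restrict (σ : Sim G H) {X : Set V} {Y : Set V'} (h1 : ∀ v, v ∈ X → σ.f v ∈ Y)
    (h2 : ∀ v, G.ty v ≠ .bang → σ.f v ∈ Y → v ∈ X)
    (h3 : ∀ v g, G.ty g = .bang → v ∈ X → v ∈ G.bsucc g → σ.f g ∈ Y → g ∈ X) :
    Sim (G.restrict X) (H.restrict Y) where
  f v := ⟨σ.f v.1, h1 _ v.2⟩
  r e e' := σ.r e.1 e'.1
  good := σ.good.restrict X
  down := σ.down.restrict Y
  ty v := σ.ty v.1
  inj v v' hv h := Subtype.ext (σ.inj v.1 v'.1 hv (congrArg Subtype.val h))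
  surj w hw := by
    obtain ⟨v, hv⟩ := σ.surj w.1 hw
    have hty : G.ty v ≠ .bang := by rw [← σ.ty, hv]; exact hw
    exact ⟨⟨v, h2 v hty (hv ▸ w.2)⟩, Subtype.ext hv⟩
  rs e e' h := Subtype.ext (σ.rs _ _ h)
  rt e e' h := Subtype.ext (σ.rt _ _ h)
  rsig e e' h := σ.rsig _ _ h
  tot e he := by
    obtain ⟨e', he'⟩ := σ.tot e.1 he
    exact ⟨⟨e', σ.rs _ _ he' ▸ h1 _ e.2.1, σ.rt _ _ he' ▸ h1 _ e.2.2⟩, he'⟩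
  un e e₁ e₂ a b := Subtype.ext (σ.un _ _ _ a b)
  tot' e' he' := by
    obtain ⟨e, he⟩ := σ.tot' e'.1 he'
    have hs := σ.sig he
    exact ⟨⟨e, h2 _ hs.1 (by rw [σ.rs _ _ he]; exact e'.2.1),
      h2 _ hs.2 (by rw [σ.rt _ _ he]; exact e'.2.2)⟩, he⟩
  un' e₁ e₂ e' a b := Subtype.ext (σ.un' _ _ _ a b)
  lift v h hh hv := by
    rw [bsucc_restrict] at hv
    obtain ⟨g, hg, hvg⟩ := σ.lift v.1 h.1 hh hv
    have hty : G.ty g = .bang := by rw [← σ.ty, hg]; exact hh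
    exact ⟨⟨g, h3 v.1 g hty v.2 hvg (hg ▸ h.2)⟩, Subtype.ext hg, bsucc_restrict.2 hvg⟩
  push v g hv hg h := bsucc_restrict.2 (σ.push v.1 g.1 hv hg (bsucc_restrict.1 h))
  disj g₁ g₂ hg hf hne v hv1 hv2 :=
    σ.disj g₁.1 g₂.1 hg (congrArg Subtype.val hf) (fun h => hne (Subtype.ext h)) v.1
      (bsucc_restrict.1 hv1) (bsucc_restrict.1 hv2)
  fin h hh := by
    refine Set.Finite.subset ((σ.fin h.1 hh).preimage (f := Subtype.val)
      (Subtype.val_injective.injOn)) ?_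
    intro g hg
    exact congrArg Subtype.val hg
  finT := by
    refine Set.Finite.subset (σ.finT.preimage (f := Subtype.val)
      (Subtype.val_injective.injOn)) ?_
    rintro c ⟨hc, g, hg, hcg, hn⟩
    exact ⟨hc, g.1, hg, bsucc_restrict.1 hcg, fun h => hn (bsucc_restrict.2 h)⟩

/-- Restricting the left hand side. -/
def restrictLeft (σ : Sim G H) {X : Set V}
    (h2 : ∀ v, G.ty v ≠ .bang → v ∈ X)
    (h3 : ∀ v g, G.ty g = .bang → v ∈ X → v ∈ G.bsucc g → g ∈ X) :
    Sim (G.restrict X) H where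
  f v := σ.f v.1
  r e e' := σ.r e.1 e'
  good := σ.good.restrict X
  down := σ.down
  ty v := σ.ty v.1
  inj v v' hv h := Subtype.ext (σ.inj v.1 v'.1 hv h)
  surj w hw := by
    obtain ⟨v, hv⟩ := σ.surj w hw
    have hty : G.ty v ≠ .bang := by rw [← σ.ty, hv]; exact hw
    exact ⟨⟨v, h2 v hty⟩, hv⟩
  rs e e' h := (σ.rs _ _ h)
  rt e e' h := (σ.rt _ _ h)
  rsig e e' h := σ.rsig _ _ h
  tot e he := σ.tot e.1 he
  un e e₁ e₂ a b := (σ.un _ _ _ a b)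
  tot' e' he' := by
    obtain ⟨e, he⟩ := σ.tot' e' he'
    have hs := σ.sig he
    exact ⟨⟨e, h2 _ hs.1, h2 _ hs.2⟩, he⟩
  un' e₁ e₂ e' a b := Subtype.ext (σ.un' _ _ _ a b)
  lift v h hh hv := by
    obtain ⟨g, hg, hvg⟩ := σ.lift v.1 h hh hv
    have hty : G.ty g = .bang := by rw [← σ.ty, hg]; exact hh
    exact ⟨⟨g, h3 v.1 g hty v.2 hvg⟩, hg, bsucc_restrict.2 hvg⟩
  push v g hv hg h := (σ.push v.1 g.1 hv hg (bsucc_restrict.1 h))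
  disj g₁ g₂ hg hf hne v hv1 hv2 :=
    σ.disj g₁.1 g₂.1 hg hf (fun h => hne (Subtype.ext h)) v.1
      (bsucc_restrict.1 hv1) (bsucc_restrict.1 hv2)
  fin h hh := (σ.fin h hh).preimage (f := Subtype.val) (Subtype.val_injective.injOn)
  finT := by
    refine Set.Finite.subset (σ.finT.preimage (f := Subtype.val)
      (Subtype.val_injective.injOn)) ?_
    rintro c ⟨hc, g, hg, hcg, hn⟩
    exact ⟨hc, g.1, hg, bsucc_restrict.1 hcg, hn⟩

theorem fib_bang (σ : Sim G H) {h : V'} (hh : H.ty h = .bang) :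
    ∀ g ∈ {g | σ.f g = h}, G.ty g = .bang := by
  intro g hg
  have h' : σ.f g = h := hg
  rw [← σ.ty, h', hh]

theorem mem_boxes (σ : Sim G H) {h : V'} (hh : H.ty h = .bang) {v : V}
    (hv : σ.f v ∈ H.bsucc h) : v ∈ G.boxes {g | σ.f g = h} := by
  obtain ⟨g, hg, hvg⟩ := σ.lift v h hh hv
  exact ⟨g, hg, hvg⟩

theorem of_mem_boxes (σ : Sim G H) {h : V'} (hh : H.ty h = .bang) {v : V} (hv : G.ty v ≠ .bang)
    (hm : v ∈ G.boxes {g | σ.f g = h}) : σ.f v ∈ H.bsucc h := by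
  obtain ⟨g, rfl, hvg⟩ := hm
  exact σ.push v g hv (by rw [← σ.ty, hh]) hvg

theorem kill (σ : Sim G H) {h : V'} (hh : H.ty h = .bang) :
    ∃ A : BGraph, Reach ⟨_, _, G⟩ A ∧ Nonempty (Sim A.G (H.killGraph h)) := by
  have hF := σ.fib_bang hh
  refine ⟨_, reach_kill σ.good (σ.fin h hh) hF, ⟨σ.restrict ?_ ?_ ?_⟩⟩
  · intro v hv hm
    exact hv (σ.mem_boxes hh hm)
  · intro v hv hm hb
    exact hm (σ.of_mem_boxes hh hv hb)
  · intro v g hg hv hvg _ hgb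
    exact hv ((σ.good.clo_boxes hF).sub hg hgb hvg)

theorem drop (σ : Sim G H) {h : V'} (hh : H.ty h = .bang) :
    ∃ A : BGraph, Reach ⟨_, _, G⟩ A ∧ Nonempty (Sim A.G (H.dropGraph h)) := by
  have hF := σ.fib_bang hh
  exact ⟨_, reach_drop (σ.fin h hh) hF,
    ⟨σ.restrict (fun v hv => hv) (fun v _ hv => hv) (fun v g _ _ _ hg => hg)⟩⟩

theorem fix (σ : Sim G H) :
    ∃ A : BGraph, Reach ⟨_, _, G⟩ A ∧ ∃ τ : Sim A.G H,
      ∀ c g, A.G.ty c = .bang → A.G.ty g = .bang → c ∈ A.G.bsucc g →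
        τ.f c ∉ H.bsucc (τ.f g) → ∃ x, A.G.ty x ≠ .bang ∧ x ∈ A.G.bsucc c := by
  let T := {c | G.ty c = .bang ∧ ∃ g, G.ty g = .bang ∧ c ∈ G.bsucc g ∧ σ.f c ∉ H.bsucc (σ.f g)}
  let F := {c | c ∈ T ∧ ∀ x ∈ G.bsucc c, G.ty x = .bang}
  have hfin : F.Finite := σ.finT.subset fun c hc => hc.1
  have hF : ∀ g ∈ F, G.ty g = .bang := fun g hg => hg.1.1
  have h2 : ∀ v, G.ty v ≠ .bang → v ∈ (G.boxes F)ᶜ := by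
    rintro v hv ⟨c, hc, hm⟩
    exact hv (hc.2 v hm)
  refine ⟨_, reach_kill σ.good hfin hF, σ.restrictLeft h2 ?_, ?_⟩
  · intro v g hg hv hvg hgb
    exact hv ((σ.good.clo_boxes hF).sub hg hgb hvg)
  · intro c g hc hg hcg hn
    have hT : c.1 ∈ T := ⟨hc, g.1, hg, bsucc_restrict.1 hcg, hn⟩
    have hcF : c.1 ∉ F := fun h => c.2 ⟨c.1, h, σ.good.rfl' _ hc⟩
    by_contra hcon
    refine hcF ⟨hT, fun x hx => ?_⟩
    by_contra hxb
    exact hcon ⟨⟨x, h2 x hxb⟩, hxb, bsucc_restrict.2 hx⟩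

end Sim
namespace Sim
variable {V E V' E' : Type} {G : TGraph V E} {H : TGraph V' E'}

theorem mvrel_eq {b b' v w : V} : Quot.mk (mergeVRel b b') v = Quot.mk (mergeVRel b b') w ↔
    mergeVRel b b' v w := by
  refine ⟨fun h => ?_, Quot.sound⟩
  have heq : Equivalence (mergeVRel b b') := by
    refine ⟨fun x => Or.inl rfl, ?_, ?_⟩
    · rintro x y (h | ⟨h1, h2⟩ | ⟨h1, h2⟩) <;> subst_vars <;> simp [mergeVRel]
    · rintro x y z (h | ⟨h1, h2⟩ | ⟨h1, h2⟩) (h' | ⟨h3, h4⟩ | ⟨h3, h4⟩) <;> subst_vars <;>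
        simp_all [mergeVRel]
  exact (heq.eqvGen_iff).1 (Quot.eqvGen_exact h)

theorem merge_ty {b b' : V} (hb : G.ty b = .bang) (hb' : G.ty b' = .bang) (v : V) :
    (G.mergeGraph b b').ty (Quot.mk _ v) = G.ty v := by
  rw [mergeGraph_ty_mk]
  split_ifs with h
  · rw [h, hb, hb']
  · rfl

theorem merge_bsucc {b b' k x : V} :
    Quot.mk _ x ∈ (G.mergeGraph b b').bsucc (Quot.mk _ k) ↔
      ∃ x' k', mergeVRel b b' x' x ∧ mergeVRel b b' k' k ∧ x' ∈ G.bsucc k' := by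
  constructor
  · rintro ⟨⟨e⟩, hs, ht⟩
    exact ⟨G.t e, G.s e, mvrel_eq.1 ht, mvrel_eq.1 hs, e, rfl, rfl⟩
  · rintro ⟨x', k', h1, h2, e, rfl, rfl⟩
    exact ⟨Quot.mk _ e, Quot.sound h2, Quot.sound h1⟩

theorem merge_edge {b b' : V} (hg3 : ∀ e, G.ty (G.t e) = .bang → G.ty (G.s e) = .bang)
    (hb : G.ty b = .bang) (hb' : G.ty b' = .bang) {e₁ e₂ : E}
    (h : Quot.mk (G.mergeERel b b') e₁ = Quot.mk (G.mergeERel b b') e₂)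
    (h1 : e₁ ∈ G.sigmaEdges) : e₁ = e₂ := by
  have hup : ∀ c, G.ty c = .bang → ∀ e ∈ G.upEdges c, G.ty (G.s e) = .bang := by
    rintro c hc e ⟨⟨e', h1, h2⟩, _⟩
    rw [← h1]; apply hg3; rw [h2, hc]
  have key : ∀ x y, Relation.EqvGen (G.mergeERel b b') x y →
      (x = y ∨ (G.ty (G.s x) = .bang ∧ G.ty (G.s y) = .bang)) := by
    intro x y hxy
    induction hxy with
    | rel x y h =>
      rcases h with h | ⟨h1, h2, _⟩ | ⟨h1, h2, _⟩
      · exact Or.inl h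
      · exact Or.inr ⟨hup _ hb _ h1, hup _ hb' _ h2⟩
      · exact Or.inr ⟨hup _ hb' _ h1, hup _ hb _ h2⟩
    | refl x => exact Or.inl rfl
    | symm x y _ ih => exact ih.imp Eq.symm And.symm
    | trans x y z _ _ ih1 ih2 =>
      rcases ih1 with rfl | ih1
      · exact ih2
      · rcases ih2 with rfl | ih2
        · exact Or.inr ih1
        · exact Or.inr ⟨ih1.1, ih2.2⟩
  rcases key _ _ (Quot.eqvGen_exact h) with h | h
  · exact h
  · exact (h1.1 h.1).elim

/-- In a graph where `b`, `b'` may be merged, boxes not based at `b` or `b'` contain both or none. -/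
theorem merge_swap {b b' : V} (hpred : G.bpred b \ {b} = G.bpred b' \ {b'})
    {x x' k : V} (hx : mergeVRel b b' x' x) (h : x' ∈ G.bsucc k) :
    x ∈ G.bsucc k ∨ (mergeVRel b b' x k) := by
  rcases hx with rfl | ⟨rfl, rfl⟩ | ⟨rfl, rfl⟩
  · exact Or.inl h
  · by_cases hk : k = x'
    · subst hk; exact Or.inr (Or.inr (Or.inr ⟨rfl, rfl⟩))
    · have : k ∈ G.bpred x' \ {x'} := ⟨h, hk⟩
      rw [hpred] at this
      exact Or.inl this.1
  · by_cases hk : k = x'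
    · subst hk; exact Or.inr (Or.inr (Or.inl ⟨rfl, rfl⟩))
    · have : k ∈ G.bpred x' \ {x'} := ⟨h, hk⟩
      rw [← hpred] at this
      exact Or.inl this.1

theorem merge_down (hG : G.Down) {b b' : V} (hb : G.ty b = .bang) (hb' : G.ty b' = .bang)
    (hpred : G.bpred b \ {b} = G.bpred b' \ {b'}) : (G.mergeGraph b b').Down := by
  refine ⟨?_, ?_⟩
  · rintro ⟨e⟩
    change (G.mergeGraph b b').ty (Quot.mk _ (G.t e)) = _ →
      (G.mergeGraph b b').ty (Quot.mk _ (G.s e)) = _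
    rw [merge_ty hb hb', merge_ty hb hb']
    exact hG.g3 e
  · rintro ⟨k⟩ ⟨e⟩ hk
    change (G.mergeGraph b b').ty (Quot.mk _ k) = _ at hk
    change (G.mergeGraph b b').ty (Quot.mk _ (G.s e)) = _ →
      Quot.mk _ (G.s e) ∈ (G.mergeGraph b b').bsucc (Quot.mk _ k) →
      Quot.mk _ (G.t e) ∈ (G.mergeGraph b b').bsucc (Quot.mk _ k)
    rw [merge_ty hb hb'] at hk ⊢
    rw [merge_bsucc]
    rintro hs ⟨x', k', hx', hk', hm⟩
    rcases merge_swap hpred hx' hm with h | h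
    · refine merge_bsucc.2 ⟨G.t e, k', Or.inl rfl, hk', hG.down k' e ?_ hs h⟩
      rw [← merge_ty hb hb', mvrel_eq.2 hk', merge_ty hb hb', hk]
    · rw [← mvrel_eq.2 hk', ← mvrel_eq.2 h]
      exact ⟨Quot.mk _ e, rfl, rfl⟩

/-- Merging on the right hand side. -/
def mergeRight (σ : Sim G H) {h h' : V'} (hb : H.ty h = .bang) (hb' : H.ty h' = .bang)
    (hpred : H.bpred h \ {h} = H.bpred h' \ {h'}) (hdisj : H.bsucc h ∩ H.bsucc h' = ∅)
    (hfix : ∀ c g, G.ty c = .bang → G.ty g = .bang → c ∈ G.bsucc g →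
        σ.f c ∉ H.bsucc (σ.f g) → ∃ x, G.ty x ≠ .bang ∧ x ∈ G.bsucc c) :
    Sim G (H.mergeGraph h h') where
  f v := Quot.mk _ (σ.f v)
  r e e' := ∃ e₁, σ.r e e₁ ∧ Quot.mk _ e₁ = e'
  good := σ.good
  down := merge_down σ.down hb hb' hpred
  ty v := by rw [merge_ty hb hb', σ.ty]
  inj v v' hv hq := by
    have hv' : H.ty (σ.f v) ≠ .bang := by rwa [σ.ty]
    rcases mvrel_eq.1 hq with e | ⟨e, _⟩ | ⟨e, _⟩
    · exact σ.inj v v' hv e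
    · rw [e] at hv'; exact (hv' hb).elim
    · rw [e] at hv'; exact (hv' hb').elim
  surj := by
    rintro ⟨w⟩ hw
    change (H.mergeGraph h h').ty (Quot.mk _ w) ≠ _ at hw
    rw [merge_ty hb hb'] at hw
    obtain ⟨v, rfl⟩ := σ.surj w hw
    exact ⟨v, rfl⟩
  rs := by
    rintro e _ ⟨e₁, h1, rfl⟩
    exact congrArg _ (σ.rs _ _ h1)
  rt := by
    rintro e _ ⟨e₁, h1, rfl⟩
    exact congrArg _ (σ.rt _ _ h1)
  rsig := by
    rintro e _ ⟨e₁, h1, rfl⟩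
    have := σ.rsig _ _ h1
    change (H.mergeGraph h h').ty (Quot.mk _ (H.s e₁)) ≠ _ ∧
      (H.mergeGraph h h').ty (Quot.mk _ (H.t e₁)) ≠ _
    rw [merge_ty hb hb', merge_ty hb hb']
    exact this
  tot e he := by
    obtain ⟨e', he'⟩ := σ.tot e he
    exact ⟨_, e', he', rfl⟩
  un := by
    rintro e _ _ ⟨e₁, h1, rfl⟩ ⟨e₂, h2, rfl⟩
    rw [σ.un _ _ _ h1 h2]
  tot' := by
    rintro ⟨e'⟩ he'
    change (H.mergeGraph h h').ty (Quot.mk _ (H.s e')) ≠ _ ∧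
      (H.mergeGraph h h').ty (Quot.mk _ (H.t e')) ≠ _ at he'
    rw [merge_ty hb hb', merge_ty hb hb'] at he'
    obtain ⟨e, he⟩ := σ.tot' e' he'
    exact ⟨e, e', he, rfl⟩
  un' := by
    rintro e e' _ ⟨e₁, h1, rfl⟩ ⟨e₂, h2, hq⟩
    have := merge_edge σ.down.g3 hb hb' hq (σ.rsig _ _ h2)
    subst this
    exact σ.un' _ _ _ h1 h2
  lift := by
    rintro v ⟨k⟩ hk hv
    change (H.mergeGraph h h').ty (Quot.mk _ k) = _ at hk
    rw [merge_ty hb hb'] at hk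
    obtain ⟨x', k', hx', hk', hm⟩ := merge_bsucc.1 hv
    have hkb : H.ty k' = .bang := by
      rw [← merge_ty hb hb', mvrel_eq.2 hk', merge_ty hb hb', hk]
    rcases merge_swap hpred hx' hm with h1 | h1
    · obtain ⟨g, rfl, hvg⟩ := σ.lift v k' hkb h1
      exact ⟨g, Quot.sound hk', hvg⟩
    · refine ⟨v, (mvrel_eq.2 h1).trans (mvrel_eq.2 hk'), σ.good.rfl' v ?_⟩
      rw [← σ.ty, ← merge_ty hb hb', mvrel_eq.2 h1, merge_ty hb hb', hkb]
  push v g hv hg hm := merge_bsucc.2 ⟨_, _, Or.inl rfl, Or.inl rfl, σ.push v g hv hg hm⟩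
  disj := by
    have key : ∀ g₁ g₂, σ.f g₁ = h → σ.f g₂ = h' → ∀ v, v ∈ G.bsucc g₁ → v ∈ G.bsucc g₂ → False := by
      intro g₁ g₂ e1 e2
      have hg1 : G.ty g₁ = .bang := by rw [← σ.ty, e1, hb]
      have hg2 : G.ty g₂ = .bang := by rw [← σ.ty, e2, hb']
      have hnon : ∀ v, G.ty v ≠ .bang → v ∈ G.bsucc g₁ → v ∈ G.bsucc g₂ → False := by
        intro v hv h1 h2
        have : σ.f v ∈ H.bsucc h ∩ H.bsucc h' :=
          ⟨e1 ▸ σ.push v g₁ hv hg1 h1, e2 ▸ σ.push v g₂ hv hg2 h2⟩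
        rw [hdisj] at this
        exact this
      intro v h1 h2
      by_cases hv : G.ty v = .bang
      · have hx : ∃ x, G.ty x ≠ .bang ∧ x ∈ G.bsucc v := by
          by_contra hcon
          have a1 : σ.f v ∈ H.bsucc h := by
            by_contra hn
            exact hcon (hfix v g₁ hv hg1 h1 (by rwa [e1]))
          have a2 : σ.f v ∈ H.bsucc h' := by
            by_contra hn
            exact hcon (hfix v g₂ hv hg2 h2 (by rwa [e2]))
          have : σ.f v ∈ H.bsucc h ∩ H.bsucc h' := ⟨a1, a2⟩
          rw [hdisj] at this
          exact this
        obtain ⟨x, hxb, hxv⟩ := hx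
        exact hnon x hxb (σ.good.down hg1 hv h1 hxv) (σ.good.down hg2 hv h2 hxv)
      · exact hnon v hv h1 h2
    intro g₁ g₂ hg hq hne v h1 h2
    rcases mvrel_eq.1 hq with e | ⟨e, e'⟩ | ⟨e, e'⟩
    · exact σ.disj g₁ g₂ hg e hne v h1 h2
    · exact key g₁ g₂ e e' v h1 h2
    · exact key g₂ g₁ e' e v h2 h1
  fin := by
    rintro ⟨k⟩ hk
    change (H.mergeGraph h h').ty (Quot.mk _ k) = _ at hk
    rw [merge_ty hb hb'] at hk
    refine (((σ.fin k hk).union (σ.fin h hb)).union (σ.fin h' hb')).subset ?_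
    intro g hg
    rcases mvrel_eq.1 hg with e | ⟨e, _⟩ | ⟨e, _⟩
    · exact Or.inl (Or.inl e)
    · exact Or.inl (Or.inr e)
    · exact Or.inr e
  finT := by
    refine σ.finT.subset ?_
    rintro c ⟨hc, g, hg, hm, hn⟩
    exact ⟨hc, g, hg, hm, fun hx => hn (merge_bsucc.2 ⟨_, _, Or.inl rfl, Or.inl rfl, hx⟩)⟩

end Sim

section
variable {V E : Type} {G : TGraph V E} {S : Set V}

theorem sig_inl {e : E} : (Sum.inl e) ∈ (G.pcopy S).sigmaEdges ↔ e ∈ G.sigmaEdges := Iff.rfl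

theorem sig_inr {e : {e : E // G.s e ∈ S ∨ G.t e ∈ S}} :
    (Sum.inr e) ∈ (G.pcopy S).sigmaEdges ↔ e.1 ∈ G.sigmaEdges := by
  change ((G.pcopy S).ty (pembed S _) ≠ _ ∧ (G.pcopy S).ty (pembed S _) ≠ _) ↔ _
  rw [pcopy_ty_embed, pcopy_ty_embed]
  exact Iff.rfl

theorem pproj_fin {A : Set V} (hA : A.Finite) :
    {x : V ⊕ {w : V // w ∈ S} | pproj x ∈ A}.Finite := by
  refine ((hA.image Sum.inl).union ((hA.preimage (f := Subtype.val)
    (Subtype.val_injective.injOn)).image Sum.inr)).subset ?_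
  rintro (x | x) hx
  · exact Or.inl ⟨x, hx, rfl⟩
  · exact Or.inr ⟨x, hx, rfl⟩

end

namespace Sim
variable {V E V' E' : Type} {G : TGraph V E} {H : TGraph V' E'}

noncomputable def copyMap (f : V → V') (S' : Set V) (S : Set V') :
    V ⊕ {w : V // w ∈ S'} → V' ⊕ {w : V' // w ∈ S} :=
  Sum.elim (fun v => Sum.inl (f v)) (fun v => pembed S (f v.1))

theorem copyMap_proj (f : V → V') (S' : Set V) (S : Set V') (x) :
    pproj (copyMap f S' S x) = f (pproj x) := by
  rcases x with x | x
  · rfl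
  · exact pproj_pembed _

theorem copyMap_embed (f : V → V') {S' : Set V} {S : Set V'} (hm : ∀ v, f v ∈ S → v ∈ S') (v) :
    copyMap f S' S (pembed S' v) = pembed S (f v) := by
  by_cases h : v ∈ S'
  · rw [pembed_mem h]; rfl
  · rw [pembed_not h, pembed_not (fun h' => h (hm v h'))]; rfl

/-- Copying both sides. -/
noncomputable def pcopySim (σ : Sim G H) {S' : Set V} {S : Set V'}
    (hm : ∀ v, σ.f v ∈ S → v ∈ S')
    (ho : ∀ v, G.ty v ≠ .bang → v ∈ S' → σ.f v ∈ S)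
    (hS' : G.Clo S') (hS : ∀ g, H.ty g = .bang → g ∈ S → H.bsucc g ⊆ S) :
    Sim (G.pcopy S') (H.pcopy S) where
  f := copyMap σ.f S' S
  r
    | .inl e, .inl e' => σ.r e e'
    | .inr e, .inr e' => σ.r e.1 e'.1
    | _, _ => False
  good := σ.good.pcopy hS'
  down := σ.down.pcopy hS
  ty v := by rw [pcopy_ty, pcopy_ty, copyMap_proj, σ.ty]
  inj := by
    rintro (v | v) (v' | v') hv h
    · exact congrArg Sum.inl (σ.inj v v' hv (Sum.inl_injective h))
    · obtain ⟨h1, h2⟩ := pembed_inl.1 h.symm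
      have := σ.inj v v'.1 hv h1.symm
      exact (h2 (ho _ (this ▸ hv) v'.2)).elim
    · obtain ⟨h1, h2⟩ := pembed_inl.1 h
      exact (h2 (ho _ hv v.2)).elim
    · exact congrArg Sum.inr (Subtype.ext (σ.inj v.1 v'.1 hv (pembed_inj h)))
  surj := by
    rintro (w | w) hw
    · obtain ⟨v, hv⟩ := σ.surj w hw
      exact ⟨Sum.inl v, congrArg Sum.inl hv⟩
    · obtain ⟨v, hv⟩ := σ.surj w.1 hw
      exact ⟨Sum.inr ⟨v, hm v (hv ▸ w.2)⟩, pembed_inr.2 hv⟩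
  rs := by
    rintro (e | e) (e' | e') h
    · exact congrArg Sum.inl (σ.rs _ _ h)
    · exact h.elim
    · exact h.elim
    · exact (copyMap_embed σ.f hm _).trans (congrArg _ (σ.rs _ _ h))
  rt := by
    rintro (e | e) (e' | e') h
    · exact congrArg Sum.inl (σ.rt _ _ h)
    · exact h.elim
    · exact h.elim
    · exact (copyMap_embed σ.f hm _).trans (congrArg _ (σ.rt _ _ h))
  rsig := by
    rintro (e | e) (e' | e') h
    · exact σ.rsig _ _ h
    · exact h.elim
    · exact h.elim
    · exact sig_inr.2 (σ.rsig _ _ h)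
  tot := by
    rintro (e | e) h
    · obtain ⟨e', he'⟩ := σ.tot e h
      exact ⟨Sum.inl e', he'⟩
    · rw [sig_inr] at h
      obtain ⟨e', he'⟩ := σ.tot e.1 h
      refine ⟨Sum.inr ⟨e', ?_⟩, he'⟩
      rw [← σ.rs _ _ he', ← σ.rt _ _ he']
      exact e.2.imp (ho _ h.1) (ho _ h.2)
  un := by
    rintro (e | e) (e₁ | e₁) (e₂ | e₂) h1 h2
    · exact congrArg Sum.inl (σ.un _ _ _ h1 h2)
    · exact h2.elim
    · exact h1.elim
    · exact h1.elim
    · exact h1.elim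
    · exact h1.elim
    · exact h2.elim
    · exact congrArg Sum.inr (Subtype.ext (σ.un _ _ _ h1 h2))
  tot' := by
    rintro (e' | e') h
    · obtain ⟨e, he⟩ := σ.tot' e' h
      exact ⟨Sum.inl e, he⟩
    · rw [sig_inr] at h
      obtain ⟨e, he⟩ := σ.tot' e'.1 h
      refine ⟨Sum.inr ⟨e, ?_⟩, he⟩
      have := e'.2
      rw [← σ.rs _ _ he, ← σ.rt _ _ he] at this
      exact this.imp (hm _) (hm _)
  un' := by
    rintro (e₁ | e₁) (e₂ | e₂) (e | e) h1 h2
    · exact congrArg Sum.inl (σ.un' _ _ _ h1 h2)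
    · exact h1.elim
    · exact h2.elim
    · exact h1.elim
    · exact h1.elim
    · exact h2.elim
    · exact h1.elim
    · exact congrArg Sum.inr (Subtype.ext (σ.un' _ _ _ h1 h2))
  lift := by
    have key : ∀ (v : {w : V // w ∈ S'}) (h' : V') x, H.ty h' = .bang → pembed S h' = x →
        σ.f v.1 ∈ H.bsucc h' →
        ∃ g, copyMap σ.f S' S g = x ∧ Sum.inr v ∈ (G.pcopy S').bsucc g := by
      intro v h' x hh hx hv
      obtain ⟨g, hg, hvg⟩ := σ.lift v.1 h' hh hv
      refine ⟨pembed S' g, ?_, ?_⟩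
      · rw [copyMap_embed σ.f hm, hg, hx]
      · have := bsucc_embed (S := S') hvg (Or.inr v.2)
        rwa [pembed_mem v.2] at this
    rintro (v | v) (h' | h') hh hv
    · obtain ⟨g, hg, hvg⟩ := σ.lift v h' hh (bsucc_ll.1 hv)
      exact ⟨Sum.inl g, congrArg Sum.inl hg, bsucc_ll.2 hvg⟩
    · exact (bsucc_rl (hS _ hh h'.2) hv).elim
    · refine key v h' _ hh (pembed_inl.2 ⟨rfl, ?_⟩) (bsucc_proj' hv)
      intro hmem
      have hfv := hS _ hh hmem (bsucc_proj' hv)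
      change pembed S (σ.f v.1) ∈ _ at hv
      rw [pembed_mem hfv] at hv
      exact (bsucc_lr.1 hv).2 hmem
    · exact key v h'.1 _ hh (pembed_inr.2 rfl) (bsucc_proj' hv)
  push := by
    rintro (v | v) (g | g) hv hg h
    · exact bsucc_ll.2 (σ.push v g hv hg (bsucc_ll.1 h))
    · exact (bsucc_rl (hS'.sub hg g.2) h).elim
    · obtain ⟨h1, h2⟩ := bsucc_lr.1 h
      change pembed S (σ.f v.1) ∈ _
      rw [pembed_mem (ho _ hv v.2)]
      exact bsucc_lr.2 ⟨σ.push _ _ hv hg h1, fun hc => h2 (hm _ hc)⟩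
    · exact bsucc_embed (σ.push _ _ hv hg (bsucc_rr.1 h)) (Or.inr (ho _ hv v.2))
  disj := by
    intro g₁ g₂ hg hf hne v hv1 hv2
    have hp : σ.f (pproj g₁) = σ.f (pproj g₂) := by
      rw [← copyMap_proj σ.f S' S, ← copyMap_proj σ.f S' S, hf]
    rw [pcopy_ty] at hg
    by_cases hpe : pproj g₁ = pproj g₂
    · rcases g₁ with g₁ | g₁ <;> rcases g₂ with g₂ | g₂
      · exact hne (congrArg Sum.inl hpe)
      · change g₁ = g₂.1 at hpe
        subst hpe
        rcases v with v | v
        · exact bsucc_rl (hS'.sub hg g₂.2) hv2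
        · exact (bsucc_lr.1 hv1).2 g₂.2
      · change g₁.1 = g₂ at hpe
        subst hpe
        rcases v with v | v
        · exact bsucc_rl (hS'.sub hg g₁.2) hv1
        · exact (bsucc_lr.1 hv2).2 g₁.2
      · exact hne (congrArg Sum.inr (Subtype.ext hpe))
    · exact σ.disj _ _ hg hp hpe _ (bsucc_proj hv1) (bsucc_proj hv2)
  fin h hh := by
    rw [pcopy_ty] at hh
    refine (pproj_fin (σ.fin _ hh)).subset ?_
    intro g hg
    have hg' : copyMap σ.f S' S g = h := hg
    change σ.f (pproj g) = pproj h
    rw [← hg', copyMap_proj]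
  finT := by
    refine (pproj_fin σ.finT).subset ?_
    rintro c ⟨hc, g, hg, hcg, hn⟩
    rw [pcopy_ty] at hc hg
    refine ⟨hc, pproj g, hg, bsucc_proj hcg, fun hfc => hn ?_⟩
    rcases c with c | c <;> rcases g with g | g
    · exact bsucc_ll.2 hfc
    · exact (bsucc_rl (hS'.sub hg g.2) hcg).elim
    · have hgS : σ.f g ∉ S := fun h => (bsucc_lr.1 hcg).2 (hm _ h)
      change pembed S (σ.f c.1) ∈ (H.pcopy S).bsucc (Sum.inl (σ.f g))
      by_cases hcS : σ.f c.1 ∈ S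
      · rw [pembed_mem hcS]; exact bsucc_lr.2 ⟨hfc, hgS⟩
      · rw [pembed_not hcS]; exact bsucc_ll.2 hfc
    · change pembed S (σ.f c.1) ∈ (H.pcopy S).bsucc (pembed S (σ.f g.1))
      by_cases hcS : σ.f g.1 ∈ S ∨ σ.f c.1 ∈ S
      · exact bsucc_embed hfc hcS
      · rw [not_or] at hcS
        rw [pembed_not hcS.1, pembed_not hcS.2]; exact bsucc_ll.2 hfc

theorem copy (σ : Sim G H) {h : V'} (hh : H.ty h = .bang) :
    ∃ A : BGraph, Reach ⟨_, _, G⟩ A ∧ Nonempty (Sim A.G (H.copyGraph h)) := by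
  have hF := σ.fib_bang hh
  refine ⟨_, reach_copy σ.good (σ.fin h hh) hF ?_, ⟨?_⟩⟩
  · intro g₁ h1 g₂ h2 hne v hv1 hv2
    have h1' : σ.f g₁ = h := h1
    have h2' : σ.f g₂ = h := h2
    exact σ.disj g₁ g₂ (hF _ h1) (h1'.trans h2'.symm) hne v hv1 hv2
  · rw [copyGraph_eq]
    exact σ.pcopySim (fun v hv => σ.mem_boxes hh hv) (fun v hv hm => σ.of_mem_boxes hh hv hm)
      (σ.good.clo_boxes hF) (fun g hg hm x hx => σ.down.down' hh hg hm hx)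

/-- The initial simulation. -/
def start {V E : Type} {G : TGraph V E} {e₀ : E} (hG : G.IsPattern)
    (hb₁ : G.ty (G.s e₀) = .bang) (hb₂ : G.ty (G.t e₀) = .bang)
    (hH : (G.delEdge e₀).IsPattern) : Sim G (G.delEdge e₀) where
  f v := v
  r e e' := e = e'.1 ∧ e ∈ G.sigmaEdges
  good := hG.good
  down := hH.down
  ty _ := rfl
  inj _ _ _ h := h
  surj w _ := ⟨w, rfl⟩
  rs := by rintro e e' ⟨rfl, _⟩; rfl
  rt := by rintro e e' ⟨rfl, _⟩; rfl
  rsig := by rintro e e' ⟨rfl, h⟩; exact h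
  tot e he := ⟨⟨e, by rintro rfl; exact he.1 hb₁⟩, rfl, he⟩
  un := by rintro e e₁ e₂ ⟨h, _⟩ ⟨h', _⟩; exact Subtype.ext (h.symm.trans h')
  tot' e' he' := ⟨e'.1, rfl, he'⟩
  un' := by rintro e₁ e₂ e' ⟨h, _⟩ ⟨h', _⟩; exact h.trans h'.symm
  lift := by
    rintro v h _ ⟨e, hs, ht⟩
    exact ⟨h, rfl, e.1, hs, ht⟩
  push := by
    rintro v g hv _ ⟨e, hs, ht⟩
    exact ⟨⟨e, by rintro rfl; exact hv (ht ▸ hb₂)⟩, hs, ht⟩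
  disj _ _ _ h hne := (hne h).elim
  fin h _ := Set.finite_singleton h
  finT := by
    refine (Set.finite_singleton (G.t e₀)).subset ?_
    rintro c ⟨_, g, _, ⟨e, hs, ht⟩, hn⟩
    by_cases h : e = e₀
    · subst h; exact ht.symm
    · exact (hn ⟨⟨e, h⟩, hs, ht⟩).elim

theorem step {A B B' : BGraph} (σ : Sim A.G B.G) (h : OpStep B B') :
    ∃ A', Reach A A' ∧ Nonempty (Sim A'.G B'.G) := by
  cases h with
  | copy b hb => exact σ.copy hb
  | drop b hb => exact σ.drop hb
  | kill b hb => exact σ.kill hb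
  | merge b b' hb hb' hpred hdisj =>
    obtain ⟨A', hA', τ, hτ⟩ := σ.fix
    exact ⟨A', hA', ⟨τ.mergeRight hb hb' hpred hdisj hτ⟩⟩

theorem steps {A B B' : BGraph} (σ : Sim A.G B.G) (h : Relation.ReflTransGen OpStep B B') :
    ∃ A', Reach A A' ∧ Nonempty (Sim A'.G B'.G) := by
  induction h with
  | refl => exact ⟨A, Reach.rfl, ⟨σ⟩⟩
  | tail _ h ih =>
    obtain ⟨A', hA', ⟨τ⟩⟩ := ih
    obtain ⟨A'', hA'', hτ⟩ := τ.step h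
    exact ⟨A'', hA'.trans hA'', hτ⟩

theorem iso (σ : Sim G H) (hH : ∀ v, H.ty v ≠ .bang) : Nonempty (GIso G H) := by
  have hG : ∀ v, G.ty v ≠ .bang := fun v => by rw [← σ.ty]; exact hH _
  choose fe hfe using fun e => σ.tot e ⟨hG _, hG _⟩
  exact ⟨⟨⟨σ.f, fe, fun e => (σ.rs _ _ (hfe e)).symm, fun e => (σ.rt _ _ (hfe e)).symm, σ.ty⟩,
    ⟨fun v v' h => σ.inj v v' (hG v) h, fun w => σ.surj w (hH w)⟩,
    ⟨fun e e' h => by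
      have h' : fe e = fe e' := h
      exact σ.un' _ _ _ (hfe e) (h' ▸ hfe e'), fun e' => by
      obtain ⟨e, he⟩ := σ.tot' e' ⟨hH _, hH _⟩
      exact ⟨e, σ.un _ _ _ (hfe e) he⟩⟩⟩⟩

end Sim

end TGraph

/-- Let `G` be a pattern graph in which the `!`-vertex
`b₂ = t(e₀)` is nested in the `!`-vertex `b₁ = s(e₀)`, i.e. there is an edge
`e₀` from `b₁` to `b₂` (with `b₁ ≠ b₂`), and suppose the graph `H = G∖e₀`
obtained by deleting `e₀` is again a pattern graph.  Then every instance of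
`H` is an instance of `G`. -/
theorem statement_11 {V E : Type} (G : TGraph V E) (hG : G.IsPattern)
    (e₀ : E) (hb₁ : G.ty (G.s e₀) = .bang) (hb₂ : G.ty (G.t e₀) = .bang)
    (hne : G.s e₀ ≠ G.t e₀)
    (hH : (G.delEdge e₀).IsPattern) :
    ∀ C : TGraph.BGraph,
      TGraph.IsInstanceOf C ⟨V, {e : E // e ≠ e₀}, G.delEdge e₀⟩ →
      TGraph.IsInstanceOf C ⟨V, E, G⟩ := by
  rintro C ⟨⟨C', hC', ⟨i⟩⟩, hc⟩
  refine ⟨?_, hc⟩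
  obtain ⟨A, ⟨A', hA', ⟨j⟩⟩, ⟨σ⟩⟩ :=
    TGraph.Sim.steps (A := ⟨V, E, G⟩) (TGraph.Sim.start hG hb₁ hb₂ hH) hC'
  obtain ⟨k⟩ := σ.iso (fun v => by rw [← i.toHom.map_ty]; exact hc _)
  exact ⟨A', Relation.ReflTransGen.mono (fun _ _ h => h.step) _ _ hA', ⟨(j.trans k).trans i⟩⟩
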